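/- Fix integers n and k with 3 ≤ k ≤ n. For every integer t ≥ 0, the singular homology group H_{t(k−2)}(M_{n,k}; ℤ) is a free abelian group of rank Σ_μ ( (n+1)! / (μ_1! μ_2! ⋯ μ_{t+1}!) ) · Π_{m=1}^{t} C(μ_m − 1, k − 1), where the sum is over all sequences μ = (μ_1, …, μ_{t+1}) of nonnegative integers with μ_1 + ⋯ + μ_{t+1} = n + 1 and μ_m ≥ k for all 1 ≤ m ≤ t, and C(a, b) denotes the binomial coefficient. -/

import Mathlib

open CategoryTheory

/-- The singular chain complex of a topological space with `ℤ` coefficients: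
the alternating face map complex of the free simplicial `ℤ`-module on the
singular simplicial set of `X`. -/
noncomputable def singularChainComplex (X : TopCat) : ChainComplex (ModuleCat ℤ) ℕ :=
  (AlgebraicTopology.alternatingFaceMapComplex (ModuleCat ℤ)).obj
    (((SimplicialObject.whiskering _ _).obj (ModuleCat.free ℤ)).obj (TopCat.toSSet.obj X))

/-- The `i`-th singular homology of a topological space with `ℤ` coefficients. -/
noncomputable def singularHomology (X : TopCat) (i : ℕ) : ModuleCat ℤ :=
  (singularChainComplex X).homology i

/-- The complement of the `k`-equal arrangement in `ℝ^{n+1}`: the set of points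
no `k` of whose coordinates are all equal. -/
def kEqualComplement (n k : ℕ) : Set (Fin (n + 1) → ℝ) :=
  {x | ∀ S : Finset (Fin (n + 1)), S.card = k → ¬ (∀ i ∈ S, ∀ j ∈ S, x i = x j)}

namespace KEq
open Limits AlgebraicTopology HomologicalComplex

/-- The singular chain complex as a functor. -/
noncomputable def F : TopCat.{0} ⥤ ChainComplex (ModuleCat.{0} ℤ) ℕ :=
  TopCat.toSSet ⋙ (SimplicialObject.whiskering _ _).obj (ModuleCat.free ℤ) ⋙
    alternatingFaceMapComplex (ModuleCat ℤ)

lemma F_obj (X : TopCat.{0}) : F.obj X = singularChainComplex X := rfl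

lemma F_homotopy {X Y : TopCat.{0}} {f g : X ⟶ Y} (H : TopCat.Homotopy f g) (n : ℕ) :
    homologyMap (F.map f) n = homologyMap (F.map g) n :=
  Homotopy.homologyMap_eq
    (SimplicialObject.Homotopy.toChainHomotopy
      (H.toSSet.toSimplicialObjectHomotopy.whiskerRight (ModuleCat.free ℤ))) n

/-- The continuous map as a morphism. -/
abbrev hom {X Y : Type} [TopologicalSpace X] [TopologicalSpace Y] (f : C(X, Y)) :
    TopCat.of X ⟶ TopCat.of Y := TopCat.ofHom f

lemma F_homotopic {X Y : Type} [TopologicalSpace X] [TopologicalSpace Y] {f g : C(X, Y)}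
    (h : f.Homotopic g) (n : ℕ) :
    homologyMap (F.map (hom f)) n = homologyMap (F.map (hom g)) n := by
  obtain ⟨H⟩ := h
  exact F_homotopy H n

lemma quasiIso_homotopyEquiv {X Y : Type} [TopologicalSpace X] [TopologicalSpace Y] (f : C(X, Y))
    (g : C(Y, X)) (h1 : (g.comp f).Homotopic (ContinuousMap.id X))
    (h2 : (f.comp g).Homotopic (ContinuousMap.id Y)) : QuasiIso (F.map (hom f)) := by
  rw [quasiIso_iff]
  intro n
  rw [quasiIsoAt_iff_isIso_homologyMap]
  refine ⟨homologyMap (F.map (hom g)) n, ?_, ?_⟩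
  · rw [← homologyMap_comp, ← F.map_comp]
    have := F_homotopic h1 n
    refine this.trans ?_
    have e : hom (ContinuousMap.id X) = 𝟙 _ := rfl
    rw [e, F.map_id, homologyMap_id]
  · rw [← homologyMap_comp, ← F.map_comp]
    have := F_homotopic h2 n
    refine this.trans ?_
    have e : hom (ContinuousMap.id Y) = 𝟙 _ := rfl
    rw [e, F.map_id, homologyMap_id]

instance F_map_mono {X Y : TopCat.{0}} (f : X ⟶ Y) [Mono f] : Mono (F.map f) := by
  have : Mono (TopCat.toSSet.map f) := inferInstance
  apply +allowSynthFailures HomologicalComplex.mono_of_mono_f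
  intro n
  have h2 : Mono ((TopCat.toSSet.map f).app (Opposite.op (SimplexCategory.mk n))) := inferInstance
  have h3 : Function.Injective ((TopCat.toSSet.map f).app (Opposite.op (SimplexCategory.mk n))) :=
    (mono_iff_injective _).1 h2
  change Mono ((ModuleCat.free ℤ).map ((TopCat.toSSet.map f).app _))
  rw [ModuleCat.mono_iff_injective]
  exact Finsupp.mapDomain_injective h3

/-- Relative singular chains. -/
noncomputable def rel {A X : TopCat.{0}} (i : A ⟶ X) : ChainComplex (ModuleCat.{0} ℤ) ℕ :=
  cokernel (F.map i)

/-- Quotient map to the relative chains. -/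
noncomputable def relπ {A X : TopCat.{0}} (i : A ⟶ X) : F.obj X ⟶ rel i := cokernel.π (F.map i)

instance {A X : TopCat.{0}} (i : A ⟶ X) : Epi (relπ i) :=
  coequalizer.π_epi

lemma F_relπ {A X : TopCat.{0}} (i : A ⟶ X) : F.map i ≫ relπ i = 0 := cokernel.condition _

/-- Universal property of relative chains. -/
noncomputable def relDesc {A X : TopCat.{0}} (i : A ⟶ X) {W : ChainComplex (ModuleCat.{0} ℤ) ℕ}
    (k : F.obj X ⟶ W) (hk : F.map i ≫ k = 0) : rel i ⟶ W := cokernel.desc _ k hk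

lemma relπ_relDesc {A X : TopCat.{0}} (i : A ⟶ X) {W : ChainComplex (ModuleCat.{0} ℤ) ℕ}
    (k : F.obj X ⟶ W) (hk : F.map i ≫ k = 0) : relπ i ≫ relDesc i k hk = k :=
  cokernel.π_desc _ _ _

/-- Functoriality of relative chains. -/
noncomputable def relMap {A X B Y : TopCat.{0}} (i : A ⟶ X) (j : B ⟶ Y) (a : A ⟶ B) (b : X ⟶ Y)
    (w : i ≫ b = a ≫ j) : rel i ⟶ rel j :=
  cokernel.map _ _ (F.map a) (F.map b) (by rw [← F.map_comp, ← F.map_comp, w])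

@[simp]
lemma relπ_relMap {A X B Y : TopCat.{0}} (i : A ⟶ X) (j : B ⟶ Y) (a : A ⟶ B) (b : X ⟶ Y)
    (w : i ≫ b = a ≫ j) : relπ i ≫ relMap i j a b w = F.map b ≫ relπ j := by
  exact cokernel.π_desc _ _ _

lemma relπ_relMap_assoc {A X B Y : TopCat.{0}} (i : A ⟶ X) (j : B ⟶ Y) (a : A ⟶ B) (b : X ⟶ Y)
    (w : i ≫ b = a ≫ j) {W : ChainComplex (ModuleCat.{0} ℤ) ℕ} (h : rel j ⟶ W) :
    relπ i ≫ relMap i j a b w ≫ h = F.map b ≫ relπ j ≫ h := by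
  rw [← Category.assoc, relπ_relMap, Category.assoc]

/-- The short complex of a pair. -/
noncomputable abbrev pairSC {A X : TopCat.{0}} (i : A ⟶ X) :
    ShortComplex (ChainComplex (ModuleCat.{0} ℤ) ℕ) :=
  ShortComplex.mk (F.map i) (relπ i) (F_relπ i)

lemma pair_shortExact {A X : TopCat.{0}} (i : A ⟶ X) [Mono i] : (pairSC i).ShortExact where
  exact := ShortComplex.exact_of_g_is_cokernel _ (cokernelIsCokernel (F.map i))
  mono_f := F_map_mono i
  epi_g := by dsimp; infer_instance

lemma quasiIso_relMap {A X B Y : TopCat.{0}} (i : A ⟶ X) (j : B ⟶ Y) [Mono i] [Mono j]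
    (a : A ⟶ B) (b : X ⟶ Y) (w : i ≫ b = a ≫ j) (ha : QuasiIso (F.map a))
    (hb : QuasiIso (F.map b)) : QuasiIso (relMap i j a b w) := by
  let φ : pairSC i ⟶ pairSC j :=
    { τ₁ := F.map a
      τ₂ := F.map b
      τ₃ := relMap i j a b w
      comm₁₂ := by dsimp; rw [← F.map_comp, ← F.map_comp, w]
      comm₂₃ := by simp }
  exact HomologySequence.quasiIso_τ₃ φ (pair_shortExact i) (pair_shortExact j) ha hb

lemma relπ_surj {A X : TopCat.{0}} (i : A ⟶ X) (n : ℕ) :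
    Function.Surjective ((relπ i).f n) :=
  (ModuleCat.epi_iff_surjective _).1 inferInstance

lemma F_inj {A X : TopCat.{0}} (i : A ⟶ X) [Mono i] (n : ℕ) :
    Function.Injective ((F.map i).f n) :=
  (ModuleCat.mono_iff_injective _).1 inferInstance

lemma relπ_eq_zero {A X : TopCat.{0}} (i : A ⟶ X) [Mono i] (n : ℕ) (x : (F.obj X).X n) :
    (relπ i).f n x = 0 ↔ ∃ a, (F.map i).f n a = x := by
  have h := ((pair_shortExact i).exact.map (eval _ _ n))
  rw [ShortComplex.moduleCat_exact_iff] at h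
  constructor
  · exact h x
  · rintro ⟨a, rfl⟩
    have := congrArg (fun f => f.f n) (F_relπ i)
    exact congrArg (fun f => f.hom a) this

/-- The short complex of a triple. -/
noncomputable abbrev tripleSC {A T X : TopCat.{0}} (i : A ⟶ T) (j : T ⟶ X) :
    ShortComplex (ChainComplex (ModuleCat.{0} ℤ) ℕ) :=
  ShortComplex.mk (relMap i (i ≫ j) (𝟙 A) j (by simp)) (relMap (i ≫ j) j i (𝟙 X) (by simp)) (by
    rw [← cancel_epi (relπ i)]
    simp [F_relπ, relπ_relMap_assoc])

lemma triple_shortExact {A T X : TopCat.{0}} (i : A ⟶ T) (j : T ⟶ X) [Mono i] [Mono j] :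
    (tripleSC i j).ShortExact := by
  have hepi : Epi (tripleSC i j).g := by
    refine @epi_of_epi_fac _ _ _ _ _ (relπ (i ≫ j)) _ (relπ j) _ ?_
    dsimp
    rw [relπ_relMap, F.map_id, Category.id_comp]
  have hmono : Mono (tripleSC i j).f := by
    apply +allowSynthFailures HomologicalComplex.mono_of_mono_f
    intro n
    rw [ModuleCat.mono_iff_injective, injective_iff_map_eq_zero]
    intro x hx
    obtain ⟨y, rfl⟩ := relπ_surj i n x
    have h1 := congrArg (fun f => (f.f n).hom y)
      (relπ_relMap i (i ≫ j) (𝟙 A) j (by simp))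
    have h2 : (relπ (i ≫ j)).f n ((F.map j).f n y) = 0 := by
      refine Eq.trans ?_ hx
      exact h1.symm
    rw [relπ_eq_zero] at h2
    obtain ⟨a, ha⟩ := h2
    rw [relπ_eq_zero]
    refine ⟨a, F_inj j n ?_⟩
    rw [← ha, F.map_comp]
    rfl
  refine ShortComplex.ShortExact.mk' ?_ hmono hepi
  apply ShortComplex.exact_of_g_is_cokernel
  refine CokernelCofork.IsColimit.ofπ' _ _ ?_
  intro W k hk
  have h0 : F.map j ≫ relπ (i ≫ j) ≫ k = 0 := by
    rw [← relπ_relMap_assoc i (i ≫ j) (𝟙 A) j (by simp)]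
    dsimp at hk
    rw [hk, comp_zero]
  refine ⟨relDesc j (relπ (i ≫ j) ≫ k) h0, ?_⟩
  rw [← cancel_epi (relπ (i ≫ j))]
  dsimp
  rw [relπ_relMap_assoc, F.map_id, Category.id_comp]
  exact relπ_relDesc _ _ _

end KEq

open CategoryTheory
namespace KEq
open Limits AlgebraicTopology HomologicalComplex

/-- `M` is free of rank `r`. -/
def FR (M : ModuleCat.{0} ℤ) (r : ℕ) : Prop := Nonempty (M ≃ₗ[ℤ] (Fin r → ℤ))

lemma FR.of_iso {M N : ModuleCat.{0} ℤ} {r : ℕ} (h : FR M r) (e : M ≅ N) : FR N r := by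
  obtain ⟨f⟩ := h
  exact ⟨e.toLinearEquiv.symm.trans f⟩

lemma FR.of_isIso {M N : ModuleCat.{0} ℤ} {r : ℕ} (h : FR M r) (f : M ⟶ N) [IsIso f] : FR N r :=
  h.of_iso (asIso f)

lemma FR.of_isIso' {M N : ModuleCat.{0} ℤ} {r : ℕ} (h : FR N r) (f : M ⟶ N) [IsIso f] : FR M r :=
  h.of_iso (asIso f).symm

lemma FR_zero {M : ModuleCat.{0} ℤ} (h : IsZero M) : FR M 0 := by
  have : Subsingleton M := ModuleCat.subsingleton_of_isZero h
  exact ⟨LinearEquiv.ofSubsingleton _ _⟩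

lemma FR.add {S : ShortComplex (ModuleCat.{0} ℤ)} (hS : S.ShortExact) {a b : ℕ}
    (h1 : FR S.X₁ a) (h3 : FR S.X₃ b) : FR S.X₂ (a + b) := by
  obtain ⟨e1⟩ := h1
  obtain ⟨e3⟩ := h3
  let B := ModuleCat.Basis.ofShortExact hS (Module.Basis.ofEquivFun e1) (Module.Basis.ofEquivFun e3)
  exact ⟨(B.reindex finSumFinEquiv).equivFun⟩

/-- Complexes whose homology is free of the given ranks. -/
def HB (K : ChainComplex (ModuleCat.{0} ℤ) ℕ) (b : ℕ → ℕ) : Prop := ∀ n, FR (K.homology n) (b n)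

lemma HB.of_quasiIso {K L : ChainComplex (ModuleCat.{0} ℤ) ℕ} {b : ℕ → ℕ} (h : HB K b)
    (f : K ⟶ L) (hf : QuasiIso f) : HB L b := fun n => (h n).of_iso (isoOfQuasiIsoAt f n)

lemma HB.of_quasiIso' {K L : ChainComplex (ModuleCat.{0} ℤ) ℕ} {b : ℕ → ℕ} (h : HB L b)
    (f : K ⟶ L) (hf : QuasiIso f) : HB K b := fun n => (h n).of_iso (isoOfQuasiIsoAt f n).symm

lemma rel_succ (n : ℕ) : (ComplexShape.down ℕ).Rel (n + 1) n := by simp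

lemma HB.mid {S : ShortComplex (ChainComplex (ModuleCat.{0} ℤ) ℕ)} (hS : S.ShortExact)
    (hg : ∀ n, Epi (homologyMap S.g n)) {a b : ℕ → ℕ} (h1 : HB S.X₁ a) (h3 : HB S.X₃ b) :
    HB S.X₂ (fun n => a n + b n) := by
  intro n
  have hδ : hS.δ (n + 1) n (rel_succ n) = 0 := by
    have := hg (n + 1)
    rw [← cancel_epi (homologyMap S.g (n + 1)), hS.comp_δ, comp_zero]
  have hm : Mono (homologyMap S.f n) := (hS.homology_exact₁ _ _ (rel_succ n)).mono_g hδ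
  have := hg n
  exact FR.add (ShortComplex.ShortExact.mk' (hS.homology_exact₂ n) hm this) (h1 n) (h3 n)

lemma HB.left {S : ShortComplex (ChainComplex (ModuleCat.{0} ℤ) ℕ)} (hS : S.ShortExact)
    (hf : ∀ n, Epi (homologyMap S.f n)) {a b : ℕ → ℕ} (h2 : HB S.X₂ a) (h3 : HB S.X₃ b) :
    HB S.X₁ (fun n => b (n + 1) + a n) := by
  intro n
  have hg : homologyMap S.g (n + 1) = 0 := by
    have := hf (n + 1)
    rw [← cancel_epi (homologyMap S.f (n + 1)), ← homologyMap_comp, S.zero, homologyMap_zero,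
      comp_zero]
  have hm : Mono (hS.δ (n + 1) n (rel_succ n)) := (hS.homology_exact₃ _ _ (rel_succ n)).mono_g hg
  have := hf n
  exact FR.add (ShortComplex.ShortExact.mk' (hS.homology_exact₁ _ _ (rel_succ n)) hm this)
    (h3 (n + 1)) (h2 n)

lemma HB.shift {S : ShortComplex (ChainComplex (ModuleCat.{0} ℤ) ℕ)} (hS : S.ShortExact)
    (h2 : S.X₂.Acyclic) {a : ℕ → ℕ} (h1 : HB S.X₁ a) :
    HB S.X₃ (fun n => if n = 0 then 0 else a (n - 1)) := by
  have hz : ∀ n, IsZero (S.X₂.homology n) := fun n => (h2 n).isZero_homology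
  intro n
  rcases n with _ | n
  · simp only [if_true]
    apply FR_zero
    have hg : Epi (homologyMap S.g 0) := by
      have := hS.epi_g
      have hh : Epi (S.X₃.homologyπ 0) := inferInstance
      have h0 : Epi (cyclesMap S.g 0) := by
        have e : IsIso (S.X₃.iCycles 0) := isIso_iCycles _ 0 0 (by simp) (by simp)
        have e2 : IsIso (S.X₂.iCycles 0) := isIso_iCycles _ 0 0 (by simp) (by simp)
        have : cyclesMap S.g 0 = S.X₂.iCycles 0 ≫ S.g.f 0 ≫ inv (S.X₃.iCycles 0) := by
          rw [← cancel_mono (S.X₃.iCycles 0)]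
          simp
        rw [this]
        infer_instance
      have : Epi (S.X₂.homologyπ 0 ≫ homologyMap S.g 0) := by
        rw [homologyπ_naturality]
        infer_instance
      exact epi_of_epi (S.X₂.homologyπ 0) _
    exact IsZero.of_epi (homologyMap S.g 0) (hz 0)
  · simp only [Nat.add_eq_zero_iff, one_ne_zero, and_false, if_false, Nat.add_sub_cancel]
    exact (h1 n).of_iso (hS.δIso (n + 1) n (rel_succ n) (hz _) (hz _)).symm

/-- Elementwise criterion for quasi-isomorphisms. -/
lemma quasiIso_of_elements {K L : ChainComplex (ModuleCat.{0} ℤ) ℕ} (f : K ⟶ L)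
    (hinj : ∀ n (z : K.X n) (w : L.X (n + 1)), K.d n (n - 1) z = 0 → f.f n z = L.d (n + 1) n w →
      ∃ w', z = K.d (n + 1) n w')
    (hsurj : ∀ n (z : L.X n), L.d n (n - 1) z = 0 →
      ∃ (z' : K.X n) (w : L.X (n + 1)), K.d n (n - 1) z' = 0 ∧ z = f.f n z' + L.d (n + 1) n w) :
    QuasiIso f := by
  rw [quasiIso_iff]
  intro n
  rw [quasiIsoAt_iff_isIso_homologyMap]
  have hnext : (ComplexShape.down ℕ).next n = n - 1 := by cases n <;> simp
  have hprev : (ComplexShape.down ℕ).prev n = n + 1 := by simp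
  have hex : ∀ (M : ChainComplex (ModuleCat.{0} ℤ) ℕ) (z : M.cycles n),
      M.homologyπ n z = 0 → ∃ w : M.X (n + 1), M.iCycles n z = M.d (n + 1) n w := by
    intro M z hz
    have h := ShortComplex.exact_of_g_is_cokernel
      (ShortComplex.mk _ _ (M.toCycles_comp_homologyπ (n + 1) n))
      (M.homologyIsCokernel (n + 1) n hprev)
    rw [ShortComplex.moduleCat_exact_iff] at h
    obtain ⟨w, hw⟩ := h z hz
    refine ⟨w, ?_⟩
    rw [← hw]
    exact (congrArg (fun f => f.hom w) (M.toCycles_i (n + 1) n))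
  have hex2 : ∀ (M : ChainComplex (ModuleCat.{0} ℤ) ℕ) (z : M.cycles n) (w : M.X (n + 1)),
      M.iCycles n z = M.d (n + 1) n w → M.homologyπ n z = 0 := by
    intro M z w h
    have : z = M.toCycles (n + 1) n w := by
      apply (ModuleCat.mono_iff_injective (M.iCycles n)).1 inferInstance
      rw [h]
      exact (congrArg (fun f => f.hom w) (M.toCycles_i (n + 1) n)).symm
    rw [this]
    exact congrArg (fun f => f.hom w) (M.toCycles_comp_homologyπ (n + 1) n)
  have hcyc : ∀ (M : ChainComplex (ModuleCat.{0} ℤ) ℕ) (z : M.X n), M.d n (n - 1) z = 0 →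
      ∃ z' : M.cycles n, M.iCycles n z' = z := by
    intro M z hz
    have h := ShortComplex.exact_of_f_is_kernel
      (ShortComplex.mk _ _ (M.iCycles_d n (n - 1))) (M.cyclesIsKernel n (n - 1) hnext)
    rw [ShortComplex.moduleCat_exact_iff] at h
    exact h z hz
  have hcyc2 : ∀ (M : ChainComplex (ModuleCat.{0} ℤ) ℕ) (z : M.cycles n),
      M.d n (n - 1) (M.iCycles n z) = 0 := fun M z =>
    congrArg (fun f => f.hom z) (M.iCycles_d n (n - 1))
  have hπ : ∀ (M : ChainComplex (ModuleCat.{0} ℤ) ℕ), Function.Surjective (M.homologyπ n) :=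
    fun M => (ModuleCat.epi_iff_surjective _).1 inferInstance
  have hnat : ∀ z : K.cycles n, homologyMap f n (K.homologyπ n z) =
      L.homologyπ n (cyclesMap f n z) := fun z =>
    congrArg (fun f => f.hom z) (homologyπ_naturality f n)
  have hnat2 : ∀ z : K.cycles n, L.iCycles n (cyclesMap f n z) = f.f n (K.iCycles n z) := fun z =>
    congrArg (fun f => f.hom z) (cyclesMap_i f n)
  have hm : Mono (homologyMap f n) := by
    rw [ModuleCat.mono_iff_injective, injective_iff_map_eq_zero]
    intro x hx
    obtain ⟨z, rfl⟩ := hπ K x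
    rw [hnat] at hx
    obtain ⟨w, hw⟩ := hex _ _ hx
    rw [hnat2] at hw
    obtain ⟨w', hw'⟩ := hinj n _ w (hcyc2 K z) hw
    exact hex2 _ _ _ hw'
  have he : Epi (homologyMap f n) := by
    rw [ModuleCat.epi_iff_surjective]
    intro y
    obtain ⟨z, rfl⟩ := hπ L y
    obtain ⟨z', w, h1, h2⟩ := hsurj n _ (hcyc2 L z)
    obtain ⟨z'', rfl⟩ := hcyc K z' h1
    refine ⟨K.homologyπ n z'', ?_⟩
    rw [hnat, eq_comm, ← sub_eq_zero, ← map_sub]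
    apply hex2 _ _ w
    rw [map_sub, h2, hnat2]
    abel
  exact isIso_of_mono_of_epi _

end KEq

open CategoryTheory
namespace KEq

section LA

/-- Augmented ordered chains: tuples of length `m`. -/
abbrev LA (E : Type) (m : ℕ) := (Fin m → E) →₀ ℤ

variable {E E' : Type}

noncomputable def ld (m : ℕ) : LA E (m + 1) →ₗ[ℤ] LA E m :=
  Finsupp.linearCombination ℤ
    (fun v => ∑ i : Fin (m + 1), (-1 : ℤ) ^ (i : ℕ) • Finsupp.single (v ∘ i.succAbove) 1)

lemma ld_single (m : ℕ) (v : Fin (m + 1) → E) : ld m (Finsupp.single v 1) =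
    ∑ i : Fin (m + 1), (-1 : ℤ) ^ (i : ℕ) • Finsupp.single (v ∘ i.succAbove) 1 := by
  simp [ld]

/-- Cone on ordered chains. -/
noncomputable def cone (b : E) (m : ℕ) : LA E m →ₗ[ℤ] LA E (m + 1) :=
  Finsupp.lmapDomain ℤ ℤ (fun v => (Fin.cons b v : Fin (m + 1) → E))

lemma cone_single (b : E) (m : ℕ) (v : Fin m → E) :
    cone b m (Finsupp.single v 1) = Finsupp.single (Fin.cons b v : Fin (m + 1) → E) 1 := by
  simp [cone, Finsupp.mapDomain_single]

lemma ext_single {m : ℕ} {M : Type} [AddCommGroup M] [Module ℤ M] {f g : LA E m →ₗ[ℤ] M}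
    (h : ∀ v, f (Finsupp.single v 1) = g (Finsupp.single v 1)) (c : LA E m) : f c = g c := by
  have : f = g := by
    refine Finsupp.lhom_ext' fun v => LinearMap.ext_ring (h v)
  rw [this]

lemma ld_cone_zero (b : E) (c : LA E 0) : ld 0 (cone b 0 c) = c := by
  refine ext_single (f := ld 0 ∘ₗ cone b 0) (g := LinearMap.id) (fun v => ?_) c
  simp only [LinearMap.comp_apply, cone_single, ld_single, LinearMap.id_apply]
  simp

lemma ld_cone (b : E) (m : ℕ) (c : LA E (m + 1)) :
    ld (m + 1) (cone b (m + 1) c) = c - cone b m (ld m c) := by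
  refine ext_single (f := ld (m + 1) ∘ₗ cone b (m + 1)) (g := LinearMap.id - cone b m ∘ₗ ld m)
    (fun v => ?_) c
  simp only [LinearMap.comp_apply, cone_single, ld_single, LinearMap.id_apply,
    LinearMap.sub_apply, map_sum]
  rw [Fin.sum_univ_succ, sub_eq_add_neg, ← Finset.sum_neg_distrib]
  congr 1
  · simp
  · refine Finset.sum_congr rfl fun i _ => ?_
    rw [LinearMap.map_smul, cone_single, Fin.val_succ, pow_succ, mul_neg_one, neg_smul]
    congr 3
    funext j
    refine Fin.cases ?_ (fun j => ?_) j <;> simp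

lemma ld_ld (m : ℕ) : ∀ c : LA E (m + 2), ld m (ld (m + 1) c) = 0 := by
  induction m with
  | zero =>
    refine ext_single (f := ld 0 ∘ₗ ld 1) (g := 0) (fun v => ?_)
    rw [← Fin.cons_self_tail v, ← cone_single]
    simp only [LinearMap.comp_apply, LinearMap.zero_apply]
    rw [ld_cone, map_sub, ld_cone_zero, sub_self]
  | succ m ih =>
    refine ext_single (f := ld (m + 1) ∘ₗ ld (m + 2)) (g := 0) (fun v => ?_)
    rw [← Fin.cons_self_tail v, ← cone_single]
    simp only [LinearMap.comp_apply, LinearMap.zero_apply]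
    rw [ld_cone, map_sub, ld_cone, ih]
    simp

variable (bar : ∀ m, (Fin (m + 1) → E) → E) (bar' : ∀ m, (Fin (m + 1) → E') → E')

noncomputable def lS : ∀ m, LA E m →ₗ[ℤ] LA E m
  | 0 => LinearMap.id
  | m + 1 => Finsupp.linearCombination ℤ
      (fun v => cone (bar _ v) m (lS m (ld m (Finsupp.single v 1))))

/-- Subdivision homotopy. -/
noncomputable def lT : ∀ m, LA E m →ₗ[ℤ] LA E (m + 1)
  | 0 => 0
  | m + 1 => Finsupp.linearCombination ℤ
      (fun v => cone (bar _ v) (m + 1) (Finsupp.single v 1 - lT m (ld m (Finsupp.single v 1))))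

lemma lS_single (m : ℕ) (v : Fin (m + 1) → E) : lS bar (m + 1) (Finsupp.single v 1) =
    cone (bar _ v) m (lS bar m (ld m (Finsupp.single v 1))) := by
  simp [lS]

lemma lT_single (m : ℕ) (v : Fin (m + 1) → E) : lT bar (m + 1) (Finsupp.single v 1) =
    cone (bar _ v) (m + 1) (Finsupp.single v 1 - lT bar m (ld m (Finsupp.single v 1))) := by
  simp [lT]

lemma ld_lS (m : ℕ) : ∀ c : LA E (m + 1), ld m (lS bar (m + 1) c) = lS bar m (ld m c) := by
  induction m with
  | zero =>
    refine ext_single (f := ld 0 ∘ₗ lS bar 1) (g := lS bar 0 ∘ₗ ld 0) (fun v => ?_)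
    simp only [LinearMap.comp_apply]
    rw [lS_single, ld_cone_zero]
  | succ m ih =>
    refine ext_single (f := ld (m + 1) ∘ₗ lS bar (m + 2)) (g := lS bar (m + 1) ∘ₗ ld (m + 1))
      (fun v => ?_)
    simp only [LinearMap.comp_apply]
    rw [lS_single, ld_cone, ih, ld_ld]
    simp

lemma ld_lT (m : ℕ) : ∀ c : LA E (m + 1),
    ld (m + 1) (lT bar (m + 1) c) + lT bar m (ld m c) = c - lS bar (m + 1) c := by
  induction m with
  | zero =>
    refine ext_single (f := ld 1 ∘ₗ lT bar 1 + lT bar 0 ∘ₗ ld 0) (g := LinearMap.id - lS bar 1)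
      (fun v => ?_)
    simp only [LinearMap.comp_apply, LinearMap.add_apply, LinearMap.sub_apply, LinearMap.id_apply]
    rw [lT_single, ld_cone, lS_single]
    simp [lT, lS]
  | succ m ih =>
    refine ext_single (f := ld (m + 2) ∘ₗ lT bar (m + 2) + lT bar (m + 1) ∘ₗ ld (m + 1))
      (g := LinearMap.id - lS bar (m + 2)) (fun v => ?_)
    simp only [LinearMap.comp_apply, LinearMap.add_apply, LinearMap.sub_apply, LinearMap.id_apply]
    have h := ih (ld (m + 1) (Finsupp.single v 1))
    rw [ld_ld, map_zero, add_zero] at h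
    rw [lT_single, ld_cone, lS_single, map_sub (ld (m + 1)), h, sub_sub_cancel]
    abel

variable (φ : E → E')

noncomputable def lmap (φ : E → E') (m : ℕ) : LA E m →ₗ[ℤ] LA E' m :=
  Finsupp.lmapDomain ℤ ℤ (fun v => φ ∘ v)

lemma lmap_single (m : ℕ) (v : Fin m → E) :
    lmap φ m (Finsupp.single v 1) = Finsupp.single (φ ∘ v) 1 := by
  simp [lmap, Finsupp.mapDomain_single]

lemma lmap_ld (m : ℕ) (c : LA E (m + 1)) : lmap φ m (ld m c) = ld m (lmap φ (m + 1) c) := by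
  refine ext_single (f := lmap φ m ∘ₗ ld m) (g := ld m ∘ₗ lmap φ (m + 1)) (fun v => ?_) c
  simp only [LinearMap.comp_apply, lmap_single, ld_single, map_sum, LinearMap.map_smul]
  rfl

lemma lmap_cone (b : E) (m : ℕ) (c : LA E m) :
    lmap φ (m + 1) (cone b m c) = cone (φ b) m (lmap φ m c) := by
  refine ext_single (f := lmap φ (m + 1) ∘ₗ cone b m) (g := cone (φ b) m ∘ₗ lmap φ m)
    (fun v => ?_) c
  simp only [LinearMap.comp_apply, lmap_single, cone_single]
  congr 1
  funext j
  refine Fin.cases ?_ (fun j => ?_) j <;> simp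

lemma lmap_lS (hφ : ∀ m v, bar' m (φ ∘ v) = φ (bar m v)) (m : ℕ) :
    ∀ c : LA E m, lmap φ m (lS bar m c) = lS bar' m (lmap φ m c) := by
  induction m with
  | zero => intro c; rfl
  | succ m ih =>
    refine ext_single (f := lmap φ (m + 1) ∘ₗ lS bar (m + 1))
      (g := lS bar' (m + 1) ∘ₗ lmap φ (m + 1)) (fun v => ?_)
    simp only [LinearMap.comp_apply]
    rw [lmap_single, lS_single, lS_single, lmap_cone, ih, lmap_ld, lmap_single, hφ]

lemma lmap_lT (hφ : ∀ m v, bar' m (φ ∘ v) = φ (bar m v)) (m : ℕ) :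
    ∀ c : LA E m, lmap φ (m + 1) (lT bar m c) = lT bar' m (lmap φ m c) := by
  induction m with
  | zero => intro c; simp [lT]
  | succ m ih =>
    refine ext_single (f := lmap φ (m + 2) ∘ₗ lT bar (m + 1))
      (g := lT bar' (m + 1) ∘ₗ lmap φ (m + 1)) (fun v => ?_)
    simp only [LinearMap.comp_apply]
    rw [lmap_single, lT_single, lT_single, lmap_cone, map_sub, ih, lmap_ld, lmap_single, hφ]

lemma supp_induct {m : ℕ} {M : Type} [AddCommGroup M] [Module ℤ M] (f : LA E m →ₗ[ℤ] M) (s : Set (Fin m → E))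
    (p : Submodule ℤ M) (h : ∀ v ∈ s, f (Finsupp.single v 1) ∈ p) (c : LA E m)
    (hc : c ∈ Finsupp.supported ℤ ℤ s) : f c ∈ p := by
  rw [Finsupp.supported_eq_span_single] at hc
  have : Submodule.span ℤ ((fun i => Finsupp.single i (1 : ℤ)) '' s) ≤ p.comap f := by
    rw [Submodule.span_le]
    rintro _ ⟨v, hv, rfl⟩
    exact h v hv
  exact this hc

lemma single_mem_supp {m : ℕ} {s : Set (Fin m → E)} {v : Fin m → E} (h : v ∈ s) :
    Finsupp.single v (1 : ℤ) ∈ Finsupp.supported ℤ ℤ s := Finsupp.single_mem_supported ℤ 1 h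

end LA

section mesh
variable {E : Type} [PseudoMetricSpace E] (bar : ∀ m, (Fin (m + 1) → E) → E)

lemma lS_supp
    (hb : ∀ m (v : Fin (m + 1) → E) (x : E) (R : ℝ), (∀ j, dist (v j) x ≤ R) → dist (bar _ v) x ≤ R)
    (hb' : ∀ m (v : Fin (m + 1) → E) (D : ℝ), (∀ i j, dist (v i) (v j) ≤ D) →
      ∀ j, dist (v j) (bar _ v) ≤ (m / (m + 1) : ℝ) * D)
    (M m : ℕ) (hm : m ≤ M + 1) : ∀ (v : Fin m → E) (D : ℝ), 0 ≤ D →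
    (∀ i j, dist (v i) (v j) ≤ D) →
    lS bar m (Finsupp.single v 1) ∈ Finsupp.supported ℤ ℤ
      {w : Fin m → E | (∀ i j, dist (w i) (w j) ≤ (M / (M + 1) : ℝ) * D) ∧
        ∀ x R, (∀ j, dist (v j) x ≤ R) → ∀ i, dist (w i) x ≤ R} := by
  induction m with
  | zero =>
    intro v D hD h
    apply single_mem_supp
    exact ⟨fun i => i.elim0, fun x R h => h⟩
  | succ m ih =>
    intro v D hD h
    rw [lS_single]
    have hle : (m / (m + 1) : ℝ) * D ≤ (M / (M + 1) : ℝ) * D := by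
      apply mul_le_mul_of_nonneg_right _ hD
      rw [div_le_div_iff₀ (by positivity) (by positivity)]
      have : (m : ℝ) ≤ M := by exact_mod_cast (by omega : m ≤ M)
      nlinarith
    have h1 : lS bar m (ld m (Finsupp.single v 1)) ∈ Finsupp.supported ℤ ℤ
        {w : Fin m → E | (∀ i j, dist (w i) (w j) ≤ (M / (M + 1) : ℝ) * D) ∧
        ∀ x R, (∀ j, dist (v j) x ≤ R) → ∀ i, dist (w i) x ≤ R} := by
      rw [ld_single, map_sum]
      refine Submodule.sum_mem _ fun i _ => ?_
      rw [LinearMap.map_smul]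
      refine Submodule.smul_mem _ _ ?_
      refine Finsupp.supported_mono ?_ (ih (by omega) (v ∘ i.succAbove) D hD
        (fun a b => h _ _))
      rintro w ⟨hw1, hw2⟩
      exact ⟨hw1, fun x R hx => hw2 x R fun j => hx _⟩
    refine supp_induct (cone _ m) _ _ ?_ _ h1
    rintro w ⟨hw1, hw2⟩
    rw [cone_single]
    apply single_mem_supp
    have hbw : ∀ i, dist (w i) (bar _ v) ≤ (M / (M + 1) : ℝ) * D :=
      hw2 _ _ fun j => (hb' m v D h j).trans hle
    refine ⟨fun i j => ?_, fun x R hx i => ?_⟩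
    · refine Fin.cases ?_ (fun i => ?_) i <;> refine Fin.cases ?_ (fun j => ?_) j
      · simp; positivity
      · simp only [Fin.cons_zero, Fin.cons_succ]; rw [dist_comm]; exact hbw j
      · simp only [Fin.cons_zero, Fin.cons_succ]; exact hbw i
      · simp only [Fin.cons_succ]; exact hw1 i j
    · refine Fin.cases ?_ (fun i => ?_) i
      · exact hb m v x R hx
      · exact hw2 x R hx i

lemma lS_iter_supp
    (hb : ∀ m (v : Fin (m + 1) → E) (x : E) (R : ℝ), (∀ j, dist (v j) x ≤ R) → dist (bar _ v) x ≤ R)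
    (hb' : ∀ m (v : Fin (m + 1) → E) (D : ℝ), (∀ i j, dist (v i) (v j) ≤ D) →
      ∀ j, dist (v j) (bar _ v) ≤ (m / (m + 1) : ℝ) * D)
    (m N : ℕ) (v : Fin (m + 1) → E) (D : ℝ) (hD : 0 ≤ D)
    (h : ∀ i j, dist (v i) (v j) ≤ D) :
    ((lS bar (m + 1)) ^ N) (Finsupp.single v 1) ∈ Finsupp.supported ℤ ℤ
      {w : Fin (m + 1) → E | (∀ i j, dist (w i) (w j) ≤ (m / (m + 1) : ℝ) ^ N * D)} := by
  induction N with
  | zero =>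
    rw [pow_zero, pow_zero, one_mul]
    exact single_mem_supp h
  | succ N ih =>
    rw [pow_succ' (lS bar (m + 1)), Module.End.mul_apply]
    refine supp_induct (lS bar (m + 1)) _ _ ?_ _ ih
    intro w hw
    refine Finsupp.supported_mono ?_ (lS_supp bar hb hb' m (m + 1) le_rfl w _ (by positivity) hw)
    rintro u ⟨hu, -⟩ i j
    rw [pow_succ']
    simpa [mul_assoc] using hu i j

end mesh

end KEq

open CategoryTheory
namespace KEq
open Limits AlgebraicTopology HomologicalComplex

/-- The standard simplex with `m` vertices. -/
abbrev Dl (m : ℕ) := stdSimplex ℝ (Fin m)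

/-- Affine map determined by the images of the vertices. -/
noncomputable def comb {m n : ℕ} (w : Fin m → Dl n) : C(Dl m, Dl n) where
  toFun t := ⟨∑ i, t.1 i • (w i).1,
    (convex_stdSimplex ℝ (Fin n)).sum_mem (fun i _ => t.2.1 i) t.2.2 (fun i _ => (w i).2)⟩
  continuous_toFun := by
    apply Continuous.subtype_mk
    refine continuous_finsetSum _ fun i _ => ?_
    exact ((continuous_apply i).comp continuous_subtype_val).smul continuous_const

lemma comb_val {m n : ℕ} (w : Fin m → Dl n) (t : Dl m) :
    (comb w t).1 = ∑ i, t.1 i • (w i).1 := rfl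

lemma comb_comb {l m n : ℕ} (w : Fin m → Dl n) (v : Fin l → Dl m) :
    comb (comb w ∘ v) = (comb w).comp (comb v) := by
  ext1 t
  apply Subtype.ext
  simp only [ContinuousMap.comp_apply, comb_val, Function.comp_apply, Finset.smul_sum,
    Finset.sum_apply, Finset.sum_smul, Pi.smul_apply, smul_eq_mul, mul_smul]
  rw [Finset.sum_comm]

/-- Vertices. -/
noncomputable def vtx (m : ℕ) : Fin m → Dl m := fun i => ⟨Pi.single i 1, single_mem_stdSimplex ℝ i⟩

lemma comb_vtx {m n : ℕ} (w : Fin m → Dl n) : comb w ∘ vtx m = w := by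
  funext i
  apply Subtype.ext
  simp [comb_val, vtx, Pi.single_apply]

lemma comb_vtx_id (m : ℕ) : comb (vtx m) = ContinuousMap.id (Dl m) := by
  ext1 t
  apply Subtype.ext
  funext j
  simp [comb_val, vtx, Pi.single_apply, Finset.sum_apply]

lemma comb_map {l m n : ℕ} (w : Fin m → Dl n) (f : Fin l → Fin m) (t : Dl l) :
    comb w (stdSimplex.map f t) = comb (w ∘ f) t := by
  apply Subtype.ext
  rw [comb_val, comb_val]
  have : (stdSimplex.map f t).1 = FunOnFinite.linearMap ℝ ℝ f t.1 := rfl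
  rw [this]
  simp only [FunOnFinite.linearMap_apply_apply, Finset.sum_smul, Function.comp_apply]
  rw [Finset.sum_sigma']
  refine Finset.sum_bij' (fun a _ => a.2) (fun b _ => ⟨f b, b⟩) ?_ ?_ ?_ ?_ ?_ <;> simp
  · rintro ⟨a, b⟩ h
    dsimp only at h
    subst h
    rfl
  · rintro ⟨a, b⟩ h
    dsimp only at h
    subst h
    rfl

/-- Barycenter. -/
noncomputable def bary {n : ℕ} (m : ℕ) (v : Fin (m + 1) → Dl n) : Dl n :=
  comb v ⟨fun _ => ((m + 1 : ℕ) : ℝ)⁻¹, fun _ => by positivity, by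
    simp; exact mul_inv_cancel₀ (by positivity)⟩

lemma bary_val {n : ℕ} (m : ℕ) (v : Fin (m + 1) → Dl n) :
    (bary m v).1 = ∑ i, ((m + 1 : ℕ) : ℝ)⁻¹ • (v i).1 := rfl

lemma bary_comb {n l : ℕ} (w : Fin n → Dl l) (m : ℕ) (v : Fin (m + 1) → Dl n) :
    bary m (comb w ∘ v) = comb w (bary m v) := by
  rw [bary, bary, comb_comb]
  rfl

lemma dist_comb {m n : ℕ} (v : Fin m → Dl n) (t : Dl m) (x : Dl n) (R : ℝ)
    (h : ∀ j, dist (v j) x ≤ R) : dist (comb v t) x ≤ R := by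
  have := (convex_closedBall x.1 R).sum_mem (t := Finset.univ) (w := t.1) (z := fun i => (v i).1)
    (fun i _ => t.2.1 i) t.2.2 (fun i _ => h i)
  exact this

lemma dist_bary {n : ℕ} (m : ℕ) (v : Fin (m + 1) → Dl n) (D : ℝ)
    (h : ∀ i j, dist (v i) (v j) ≤ D) (j : Fin (m + 1)) :
    dist (v j) (bary m v) ≤ (m / (m + 1) : ℝ) * D := by
  have e : (v j).1 - (bary m v).1 =
      ((m + 1 : ℕ) : ℝ)⁻¹ • ∑ i ∈ Finset.univ.erase j, ((v j).1 - (v i).1) := by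
    have h2 : ∑ i ∈ Finset.univ.erase j, ((v j).1 - (v i).1) = ∑ i, ((v j).1 - (v i).1) := by
      rw [← Finset.add_sum_erase _ _ (Finset.mem_univ j)]
      simp
    rw [h2, bary_val, Finset.sum_sub_distrib, smul_sub, Finset.smul_sum (f := fun i => (v i).1)]
    congr 1
    simp only [Finset.sum_const, Finset.card_univ, Fintype.card_fin]
    rw [← Nat.cast_smul_eq_nsmul ℝ, smul_smul, inv_mul_cancel₀ (by positivity), one_smul]
  have e2 : dist (v j) (bary m v) = ‖(v j).1 - (bary m v).1‖ := by
    rw [← dist_eq_norm]; rfl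
  rw [e2, e, norm_smul]
  have h3 : ‖∑ i ∈ Finset.univ.erase j, ((v j).1 - (v i).1)‖ ≤ m * D := by
    refine (norm_sum_le _ _).trans ?_
    refine (Finset.sum_le_card_nsmul _ _ D ?_).trans ?_
    · intro i _
      rw [← dist_eq_norm]
      exact h j i
    · simp
  calc _ ≤ ‖((m + 1 : ℕ) : ℝ)⁻¹‖ * (m * D) := by gcongr
    _ = _ := by
      rw [Real.norm_of_nonneg (by positivity)]
      push_cast
      field_simp

/-- Basis element of singular chains. -/
noncomputable def sx (X : TopCat.{0}) (n : ℕ) (σ : C(Dl (n + 1), X)) : (F.obj X).X n :=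
  ModuleCat.freeMk ((X.toSSetObjEquiv (Opposite.op (SimplexCategory.mk n))).symm σ)

/-- Extension by linearity. -/
noncomputable def clift {X : TopCat.{0}} {n : ℕ} {M : Type} [AddCommGroup M] [Module ℤ M]
    (f : C(Dl (n + 1), X) → M) : (F.obj X).X n →ₗ[ℤ] M :=
  Finsupp.linearCombination ℤ (fun s : (TopCat.toSSet.obj X).obj
    (Opposite.op (SimplexCategory.mk n)) => f (X.toSSetObjEquiv _ s))

lemma clift_sx {X : TopCat.{0}} {n : ℕ} {M : Type} [AddCommGroup M] [Module ℤ M]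
    (f : C(Dl (n + 1), X) → M) (σ : C(Dl (n + 1), X)) : clift f (sx X n σ) = f σ := by
  refine (Finsupp.linearCombination_single ℤ 1 _).trans ?_
  exact @one_smul ℤ M _ (Module.toDistribMulAction.toMulAction) _

lemma chain_ext {X : TopCat.{0}} {n : ℕ} {M : Type} [AddCommGroup M] [Module ℤ M]
    {f g : (F.obj X).X n →ₗ[ℤ] M} (h : ∀ σ, f (sx X n σ) = g (sx X n σ)) (c : (F.obj X).X n) :
    f c = g c := by
  have : f = g := by
    refine Finsupp.lhom_ext' fun v => LinearMap.ext_ring ?_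
    have := h (X.toSSetObjEquiv _ v)
    rw [sx, Equiv.symm_apply_apply] at this
    exact this
  rw [this]

lemma chain_mem {X : TopCat.{0}} {n : ℕ} (p : Submodule ℤ ((F.obj X).X n))
    (h : ∀ σ, sx X n σ ∈ p) (c : (F.obj X).X n) : c ∈ p := by
  have := chain_ext (f := p.mkQ) (g := 0) (fun σ => (Submodule.Quotient.mk_eq_zero p).2 (h σ)) c
  exact (Submodule.Quotient.mk_eq_zero p).1 this

lemma sx_map {X Y : TopCat.{0}} (f : X ⟶ Y) (n : ℕ) (σ : C(Dl (n + 1), X)) :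
    (F.map f).f n (sx X n σ) = sx Y n (f.hom.comp σ) := by
  refine (ModuleCat.free_map_apply _ _).trans ?_
  rfl

lemma hom_sum_smul {A B : ModuleCat.{0} ℤ} {ι : Type} [Fintype ι] (c : ι → ℤ) (f : ι → (A ⟶ B))
    (x : A) : (∑ i, c i • f i : A ⟶ B) x = ∑ i, c i • f i x := by
  change (∑ i, c i • f i : A ⟶ B).hom x = ∑ i, c i • (f i).hom x
  rw [ModuleCat.hom_sum, LinearMap.sum_apply]
  rfl

lemma sx_d {X : TopCat.{0}} (n : ℕ) (σ : C(Dl (n + 2), X)) :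
    (F.obj X).d (n + 1) n (sx X (n + 1) σ) =
      ∑ i : Fin (n + 2), (-1 : ℤ) ^ (i : ℕ) • sx X n (σ.comp
        ⟨stdSimplex.map i.succAbove, stdSimplex.continuous_map _⟩) := by
  have e : (F.obj X).d (n + 1) n = AlternatingFaceMapComplex.objD
      (((SimplicialObject.whiskering _ _).obj (ModuleCat.free ℤ)).obj (TopCat.toSSet.obj X)) n :=
    alternatingFaceMapComplex_obj_d _ _
  refine (congrArg (fun f => f.hom (sx X (n + 1) σ)) e).trans ?_
  refine (hom_sum_smul _ _ _).trans ?_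
  refine Finset.sum_congr rfl fun i _ => ?_
  congr 1
  refine (ModuleCat.free_map_apply _ _).trans ?_
  rfl

end KEq

open CategoryTheory
namespace KEq
open Limits AlgebraicTopology HomologicalComplex

variable {X Y : TopCat.{0}}

/-- Affine chains pushed to singular chains. -/
noncomputable def aff {n : ℕ} (σ : C(Dl n, X)) (m : ℕ) : LA (Dl n) (m + 1) →ₗ[ℤ] (F.obj X).X m :=
  Finsupp.linearCombination ℤ (fun v => sx X m (σ.comp (comb v)))

lemma aff_single {n : ℕ} (σ : C(Dl n, X)) (m : ℕ) (v : Fin (m + 1) → Dl n) :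
    aff σ m (Finsupp.single v 1) = sx X m (σ.comp (comb v)) := by
  refine (Finsupp.linearCombination_single ℤ 1 _).trans ?_
  exact one_smul ℤ _

lemma aff_d {n : ℕ} (σ : C(Dl n, X)) (m : ℕ) (c : LA (Dl n) (m + 2)) :
    (F.obj X).d (m + 1) m (aff σ (m + 1) c) = aff σ m (ld (m + 1) c) := by
  refine ext_single (f := ((F.obj X).d (m + 1) m).hom ∘ₗ aff σ (m + 1))
    (g := aff σ m ∘ₗ ld (m + 1)) (fun v => ?_) c
  simp only [LinearMap.comp_apply]
  rw [aff_single, ld_single, map_sum]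
  refine (sx_d _ _).trans ?_
  refine Finset.sum_congr rfl fun i _ => ?_
  rw [LinearMap.map_smul, aff_single]
  congr 2
  ext1 t
  exact congrArg σ (comb_map _ _ _)

lemma aff_map {n : ℕ} (f : X ⟶ Y) (σ : C(Dl n, X)) (m : ℕ) (c : LA (Dl n) (m + 1)) :
    (F.map f).f m (aff σ m c) = aff (f.hom.comp σ) m c := by
  refine ext_single (f := ((F.map f).f m).hom ∘ₗ aff σ m)
    (g := aff (f.hom.comp σ) m) (fun v => ?_) c
  simp only [LinearMap.comp_apply]
  rw [aff_single, aff_single]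
  exact sx_map _ _ _

lemma aff_comb {n l : ℕ} (σ : C(Dl n, X)) (w : Fin l → Dl n) (m : ℕ) (c : LA (Dl l) (m + 1)) :
    aff (σ.comp (comb w)) m c = aff σ m (lmap (comb w) (m + 1) c) := by
  refine ext_single (f := aff (σ.comp (comb w)) m)
    (g := aff σ m ∘ₗ lmap (comb w) (m + 1)) (fun v => ?_) c
  simp only [LinearMap.comp_apply]
  rw [lmap_single, aff_single, aff_single, comb_comb]
  rfl

/-- The tautological simplex. -/
noncomputable abbrev ee (m : ℕ) : LA (Dl m) m := Finsupp.single (vtx m) 1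

lemma aff_ee {n : ℕ} (σ : C(Dl (n + 1), X)) : aff σ n (ee (n + 1)) = sx X n σ := by
  rw [aff_single, comb_vtx_id]
  rfl

/-- Subdivision of singular chains. -/
noncomputable def sS (X : TopCat.{0}) (n : ℕ) : (F.obj X).X n →ₗ[ℤ] (F.obj X).X n :=
  clift (fun σ => aff σ n (lS bary (n + 1) (ee (n + 1))))

/-- Subdivision homotopy of singular chains. -/
noncomputable def sT (X : TopCat.{0}) (n : ℕ) : (F.obj X).X n →ₗ[ℤ] (F.obj X).X (n + 1) :=
  clift (fun σ => aff σ (n + 1) (lT bary (n + 1) (ee (n + 1))))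

lemma sS_sx (n : ℕ) (σ : C(Dl (n + 1), X)) :
    sS X n (sx X n σ) = aff σ n (lS bary (n + 1) (ee (n + 1))) := clift_sx _ _

lemma sT_sx (n : ℕ) (σ : C(Dl (n + 1), X)) :
    sT X n (sx X n σ) = aff σ (n + 1) (lT bary (n + 1) (ee (n + 1))) := clift_sx _ _

lemma sS_aff {n : ℕ} (σ : C(Dl n, X)) (m : ℕ) (c : LA (Dl n) (m + 1)) :
    sS X m (aff σ m c) = aff σ m (lS bary (m + 1) c) := by
  refine ext_single (f := sS X m ∘ₗ aff σ m) (g := aff σ m ∘ₗ lS bary (m + 1)) (fun v => ?_) c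
  simp only [LinearMap.comp_apply]
  rw [aff_single, sS_sx, aff_comb, lmap_lS bary bary _ (bary_comb v), lmap_single, comb_vtx]

lemma sT_aff {n : ℕ} (σ : C(Dl n, X)) (m : ℕ) (c : LA (Dl n) (m + 1)) :
    sT X m (aff σ m c) = aff σ (m + 1) (lT bary (m + 1) c) := by
  refine ext_single (f := sT X m ∘ₗ aff σ m) (g := aff σ (m + 1) ∘ₗ lT bary (m + 1))
    (fun v => ?_) c
  simp only [LinearMap.comp_apply]
  rw [aff_single, sT_sx, aff_comb, lmap_lT bary bary _ (bary_comb v), lmap_single, comb_vtx]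

lemma sS_map (f : X ⟶ Y) (n : ℕ) (c : (F.obj X).X n) :
    (F.map f).f n (sS X n c) = sS Y n ((F.map f).f n c) := by
  refine chain_ext (f := ((F.map f).f n).hom ∘ₗ sS X n) (g := sS Y n ∘ₗ ((F.map f).f n).hom)
    (fun σ => ?_) c
  simp only [LinearMap.comp_apply]
  rw [sS_sx]
  refine (aff_map _ _ _ _).trans ?_
  refine Eq.trans ?_ (congrArg _ (sx_map _ _ _).symm)
  rw [sS_sx]

lemma sT_map (f : X ⟶ Y) (n : ℕ) (c : (F.obj X).X n) :
    (F.map f).f (n + 1) (sT X n c) = sT Y n ((F.map f).f n c) := by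
  refine chain_ext (f := ((F.map f).f (n + 1)).hom ∘ₗ sT X n)
    (g := sT Y n ∘ₗ ((F.map f).f n).hom) (fun σ => ?_) c
  simp only [LinearMap.comp_apply]
  rw [sT_sx]
  refine (aff_map _ _ _ _).trans ?_
  refine Eq.trans ?_ (congrArg _ (sx_map _ _ _).symm)
  rw [sT_sx]

/-- The differential as a linear map. -/
noncomputable abbrev cd (X : TopCat.{0}) (n : ℕ) : (F.obj X).X (n + 1) →ₗ[ℤ] (F.obj X).X n :=
  ((F.obj X).d (n + 1) n).hom

lemma cd_sS (n : ℕ) (c : (F.obj X).X (n + 1)) :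
    cd X n (sS X (n + 1) c) = sS X n (cd X n c) := by
  refine chain_ext (f := cd X n ∘ₗ sS X (n + 1)) (g := sS X n ∘ₗ cd X n) (fun σ => ?_) c
  simp only [LinearMap.comp_apply]
  rw [← aff_ee, sS_aff]
  refine (aff_d _ _ _).trans ?_
  refine Eq.trans ?_ (congrArg _ (aff_d _ _ _).symm)
  rw [sS_aff, ld_lS]

lemma cd_sT (n : ℕ) (c : (F.obj X).X (n + 1)) :
    cd X (n + 1) (sT X (n + 1) c) + sT X n (cd X n c) = c - sS X (n + 1) c := by
  refine chain_ext (f := cd X (n + 1) ∘ₗ sT X (n + 1) + sT X n ∘ₗ cd X n)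
    (g := LinearMap.id - sS X (n + 1)) (fun σ => ?_) c
  simp only [LinearMap.comp_apply, LinearMap.add_apply, LinearMap.sub_apply, LinearMap.id_apply]
  rw [← aff_ee, sS_aff, sT_aff]
  refine (congrArg₂ (· + ·) (aff_d _ _ _) (congrArg _ (aff_d _ _ _))).trans ?_
  rw [sT_aff, ← map_add, ← map_sub, ld_lT]

lemma cd_sT_zero (c : (F.obj X).X 0) :
    cd X 0 (sT X 0 c) = c - sS X 0 c := by
  refine chain_ext (f := cd X 0 ∘ₗ sT X 0) (g := LinearMap.id - sS X 0) (fun σ => ?_) c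
  simp only [LinearMap.comp_apply, LinearMap.sub_apply, LinearMap.id_apply]
  rw [← aff_ee, sS_aff, sT_aff]
  refine (aff_d _ _ _).trans ?_
  have := ld_lT (bary (n := 1)) 0 (ee 1)
  rw [show lT (bary (n := 1)) 0 = 0 from rfl, LinearMap.zero_apply, add_zero] at this
  rw [← map_sub, this]

/-- Iterated homotopy. -/
noncomputable def sD (X : TopCat.{0}) (N n : ℕ) : (F.obj X).X n →ₗ[ℤ] (F.obj X).X (n + 1) :=
  ∑ j ∈ Finset.range N, sT X n ∘ₗ (sS X n ^ j)

lemma sSN_map (f : X ⟶ Y) (N n : ℕ) (c : (F.obj X).X n) :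
    (F.map f).f n ((sS X n ^ N) c) = (sS Y n ^ N) ((F.map f).f n c) := by
  induction N generalizing c with
  | zero => rfl
  | succ N ih =>
    rw [pow_succ, pow_succ, Module.End.mul_apply, Module.End.mul_apply, ih, sS_map]

lemma sD_map (f : X ⟶ Y) (N n : ℕ) (c : (F.obj X).X n) :
    (F.map f).f (n + 1) (sD X N n c) = sD Y N n ((F.map f).f n c) := by
  simp only [sD, LinearMap.sum_apply, LinearMap.comp_apply]
  refine (map_sum ((F.map f).f (n + 1)).hom _ _).trans ?_
  refine Finset.sum_congr rfl fun j _ => ?_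
  refine (sT_map _ _ _).trans ?_
  rw [sSN_map]

lemma cd_sSN (N n : ℕ) (c : (F.obj X).X (n + 1)) :
    cd X n ((sS X (n + 1) ^ N) c) = (sS X n ^ N) (cd X n c) := by
  induction N generalizing c with
  | zero => rfl
  | succ N ih =>
    rw [pow_succ, pow_succ, Module.End.mul_apply, Module.End.mul_apply, ih, cd_sS]

lemma cd_sD (N n : ℕ) (c : (F.obj X).X (n + 1)) :
    cd X (n + 1) (sD X N (n + 1) c) + sD X N n (cd X n c) = c - (sS X (n + 1) ^ N) c := by
  induction N with
  | zero => simp [sD]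
  | succ N ih =>
    have e : ∀ m, sD X (N + 1) m = sD X N m + sT X m ∘ₗ (sS X m ^ N) := fun m => by
      rw [sD, Finset.sum_range_succ]; rfl
    have h2 := cd_sT n ((sS X (n + 1) ^ N) c)
    rw [e, e, LinearMap.add_apply, LinearMap.add_apply, map_add, LinearMap.comp_apply,
      LinearMap.comp_apply, ← cd_sSN, pow_succ', Module.End.mul_apply]
    rw [show c - sS X (n + 1) ((sS X (n + 1) ^ N) c) =
      (c - (sS X (n + 1) ^ N) c) + ((sS X (n + 1) ^ N) c - sS X (n + 1) ((sS X (n + 1) ^ N) c))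
      by abel, ← ih, ← h2]
    abel

lemma cd_sD_zero (N : ℕ) (c : (F.obj X).X 0) :
    cd X 0 (sD X N 0 c) = c - (sS X 0 ^ N) c := by
  induction N with
  | zero => simp [sD]
  | succ N ih =>
    have e : ∀ m, sD X (N + 1) m = sD X N m + sT X m ∘ₗ (sS X m ^ N) := fun m => by
      rw [sD, Finset.sum_range_succ]; rfl
    have h2 := cd_sT_zero ((sS X 0 ^ N) c)
    rw [e, LinearMap.add_apply, map_add, LinearMap.comp_apply,
      pow_succ', Module.End.mul_apply, h2, ih]
    abel

lemma sSN_aff {n : ℕ} (σ : C(Dl n, X)) (N m : ℕ) (c : LA (Dl n) (m + 1)) :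
    (sS X m ^ N) (aff σ m c) = aff σ m ((lS bary (m + 1) ^ N) c) := by
  induction N generalizing c with
  | zero => rfl
  | succ N ih =>
    rw [pow_succ, pow_succ, Module.End.mul_apply, Module.End.mul_apply, sS_aff, ih]

end KEq

open CategoryTheory
namespace KEq
open Limits AlgebraicTopology HomologicalComplex

variable {X U V W : TopCat.{0}}

/-- Chains in the range of a map. -/
noncomputable def rg (u : U ⟶ X) (n : ℕ) : Submodule ℤ ((F.obj X).X n) :=
  LinearMap.range ((F.map u).f n).hom

lemma mem_rg (u : U ⟶ X) (n : ℕ) (c : (F.obj X).X n) : c ∈ rg u n ↔ ∃ a, (F.map u).f n a = c :=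
  Iff.rfl

lemma sx_mem_rg (u : U ⟶ X) (hu : Topology.IsEmbedding u.hom) (n : ℕ) (σ : C(Dl (n + 1), X))
    (h : ∀ t, σ t ∈ Set.range u.hom) : sx X n σ ∈ rg u n := by
  choose g hg using h
  have hc : Continuous g := by
    rw [hu.continuous_iff]
    have : (u.hom ∘ g) = σ := funext hg
    rw [this]
    exact σ.continuous
  refine ⟨sx U n ⟨g, hc⟩, ?_⟩
  refine (sx_map _ _ _).trans ?_
  congr 1
  ext1 t
  exact hg t

lemma sS_rg (u : U ⟶ X) (N n : ℕ) (c : (F.obj X).X n) (h : c ∈ rg u n) :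
    (sS X n ^ N) c ∈ rg u n := by
  obtain ⟨a, rfl⟩ := h
  exact ⟨(sS U n ^ N) a, sSN_map u N n a⟩

lemma sS_rg_sup (u : U ⟶ X) (v : V ⟶ X) (N n : ℕ) (c : (F.obj X).X n) (h : c ∈ rg u n ⊔ rg v n) :
    (sS X n ^ N) c ∈ rg u n ⊔ rg v n := by
  rw [Submodule.mem_sup] at h ⊢
  obtain ⟨a, ha, b, hb, rfl⟩ := h
  exact ⟨_, sS_rg u N n a ha, _, sS_rg v N n b hb, (map_add _ _ _).symm⟩

lemma small_simplex (u : U ⟶ X) (v : V ⟶ X) (hu : Topology.IsOpenEmbedding u.hom)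
    (hv : Topology.IsOpenEmbedding v.hom) (hcov : ∀ x, x ∈ Set.range u.hom ∨ x ∈ Set.range v.hom)
    (n : ℕ) (σ : C(Dl (n + 1), X)) : ∃ N, (sS X n ^ N) (sx X n σ) ∈ rg u n ⊔ rg v n := by
  obtain ⟨δ, hδ, hL⟩ := lebesgue_number_lemma_of_metric (s := (Set.univ : Set (Dl (n + 1))))
    (c := fun b : Bool => if b then σ ⁻¹' (Set.range u.hom) else σ ⁻¹' (Set.range v.hom))
    isCompact_univ (by
      intro b
      cases b
      · exact hv.isOpen_range.preimage σ.continuous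
      · exact hu.isOpen_range.preimage σ.continuous) (by
      intro t _
      rw [Set.mem_iUnion]
      rcases hcov (σ t) with h | h
      · exact ⟨true, h⟩
      · exact ⟨false, h⟩)
  obtain ⟨N, hN⟩ := exists_pow_lt_of_lt_one hδ
    (show (n / (n + 1) : ℝ) < 1 by rw [div_lt_one (by positivity)]; linarith)
  refine ⟨N, ?_⟩
  rw [← aff_ee, sSN_aff]
  have hd : ∀ i j, dist (vtx (n + 1) i) (vtx (n + 1) j) ≤ 1 := by
    intro i j
    have : dist (vtx (n + 1) i).1 (vtx (n + 1) j).1 ≤ 1 := by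
      rw [dist_pi_le_iff (by norm_num)]
      intro a
      simp only [vtx, Pi.single_apply]
      split_ifs <;> simp
    exact this
  have hs := lS_iter_supp (bary (n := n + 1)) (fun m v x R h => dist_comb v _ x R h)
    (fun m v D h j => dist_bary m v D h j) n N (vtx (n + 1)) 1 zero_le_one hd
  refine supp_induct _ _ _ ?_ _ hs
  intro w hw
  rw [aff_single]
  have hw' : ∀ t, comb w t ∈ Metric.ball (w 0) δ := by
    intro t
    refine lt_of_le_of_lt (dist_comb w t (w 0) _ (fun j => ?_)) hN
    simpa using hw j 0
  obtain ⟨b, hb⟩ := hL (w 0) trivial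
  cases b
  · exact Submodule.mem_sup_right (sx_mem_rg v hv.isEmbedding _ _ (fun t => hb (hw' t)))
  · exact Submodule.mem_sup_left (sx_mem_rg u hu.isEmbedding _ _ (fun t => hb (hw' t)))

lemma small_chain (u : U ⟶ X) (v : V ⟶ X) (hu : Topology.IsOpenEmbedding u.hom)
    (hv : Topology.IsOpenEmbedding v.hom) (hcov : ∀ x, x ∈ Set.range u.hom ∨ x ∈ Set.range v.hom)
    (n : ℕ) (c : (F.obj X).X n) : ∃ (N : ℕ) (a : (F.obj U).X n) (b : (F.obj V).X n),
      (sS X n ^ N) c = (F.map u).f n a + (F.map v).f n b := by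
  let p : Submodule ℤ ((F.obj X).X n) :=
    { carrier := {c | ∃ N, (sS X n ^ N) c ∈ rg u n ⊔ rg v n}
      zero_mem' := ⟨0, by simp⟩
      add_mem' := by
        rintro a b ⟨N, hN⟩ ⟨M, hM⟩
        refine ⟨N + M, ?_⟩
        rw [map_add]
        refine Submodule.add_mem _ ?_ ?_
        · rw [add_comm, pow_add, Module.End.mul_apply]
          exact sS_rg_sup _ _ _ _ _ hN
        · rw [pow_add, Module.End.mul_apply]
          exact sS_rg_sup _ _ _ _ _ hM
      smul_mem' := by
        rintro r a ⟨N, hN⟩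
        refine ⟨N, ?_⟩
        rw [LinearMap.map_smul]
        exact Submodule.smul_mem _ _ hN }
  obtain ⟨N, hN⟩ : c ∈ p := chain_mem p (fun σ => small_simplex u v hu hv hcov n σ) c
  rw [Submodule.mem_sup] at hN
  obtain ⟨_, ⟨a, rfl⟩, _, ⟨b, rfl⟩, h⟩ := hN
  exact ⟨N, a, b, h.symm⟩

lemma comp_f_apply {K L M : ChainComplex (ModuleCat.{0} ℤ) ℕ} (f : K ⟶ L) (g : L ⟶ M) (n : ℕ)
    (x : K.X n) : g.f n (f.f n x) = (f ≫ g).f n x := rfl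

lemma comm_apply {K L : ChainComplex (ModuleCat.{0} ℤ) ℕ} (f : K ⟶ L) (n m : ℕ) (x : K.X n) :
    L.d n m (f.f n x) = f.f m (K.d n m x) :=
  congrArg (fun g => g.hom x) (f.comm n m)

/-- Chains lying in both open sets lie in the intersection. -/
lemma chain_inter (u : U ⟶ X) (v : V ⟶ X) (w2 : W ⟶ V)
    (hv : Topology.IsEmbedding v.hom)
    (hw : Topology.IsEmbedding w2.hom)
    (hW : ∀ (x : U) (y : V), u.hom x = v.hom y → ∃ z : W, w2.hom z = y)
    (n : ℕ) (a : (F.obj U).X n) (b : (F.obj V).X n)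
    (h : (F.map u).f n a = (F.map v).f n b) : ∃ z, (F.map w2).f n z = b := by
  classical
  -- project the chains onto simplices lying in the image of `u`
  let e : (F.obj X).X n →ₗ[ℤ] (F.obj X).X n :=
    clift (fun σ => if ∀ t, σ t ∈ Set.range u.hom then sx X n σ else 0)
  have he1 : ∀ a : (F.obj U).X n, e ((F.map u).f n a) = (F.map u).f n a := by
    intro a
    refine chain_ext (f := e ∘ₗ ((F.map u).f n).hom) (g := ((F.map u).f n).hom) (fun σ => ?_) a
    have : ((F.map u).f n).hom (sx U n σ) = sx X n (u.hom.comp σ) := sx_map _ _ _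
    simp only [LinearMap.comp_apply]
    rw [this, clift_sx, if_pos]
    intro t
    exact ⟨σ t, rfl⟩
  have he2 : ∀ b : (F.obj V).X n, ∃ z, (F.map v).f n ((F.map w2).f n z) = e ((F.map v).f n b) := by
    intro b
    refine chain_mem ((LinearMap.range (((F.map v).f n).hom ∘ₗ ((F.map w2).f n).hom)).comap
      (e ∘ₗ ((F.map v).f n).hom)) (fun σ => ?_) b
    have : ((F.map v).f n).hom (sx V n σ) = sx X n (v.hom.comp σ) := sx_map _ _ _
    rw [Submodule.mem_comap, LinearMap.comp_apply, this, clift_sx]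
    split_ifs with hh
    · obtain ⟨z, hz⟩ := sx_mem_rg w2 hw n σ (by
        intro t
        obtain ⟨x, hx⟩ := hh t
        exact hW x (σ t) hx)
      refine ⟨z, ?_⟩
      rw [LinearMap.comp_apply, hz, this]
    · exact Submodule.zero_mem _
  obtain ⟨z, hz⟩ := he2 b
  refine ⟨z, ?_⟩
  have : Mono v := (TopCat.mono_iff_injective _).2 hv.injective
  apply F_inj v n
  rw [hz, ← h, he1, h]

end KEq

open CategoryTheory
namespace KEq
open Limits AlgebraicTopology HomologicalComplex

variable {X U V W : TopCat.{0}}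

lemma sub_rel (w : W ⟶ V) (N n : ℕ) (b : (F.obj V).X n)
    (h : ∃ y, (F.map w).f (n - 1) y = (F.obj V).d n (n - 1) b) :
    ∃ r : (F.obj W).X n, b = (sS V n ^ N) b + (F.obj V).d (n + 1) n (sD V N n b) +
      (F.map w).f n r := by
  rcases n with _ | n
  · refine ⟨0, ?_⟩
    have := cd_sD_zero N b
    have h2 : (F.obj V).d (0 + 1) 0 (sD V N 0 b) = b - (sS V 0 ^ N) b := this
    rw [h2, map_zero]
    abel
  · obtain ⟨y, hy⟩ := h
    refine ⟨sD W N n y, ?_⟩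
    have := cd_sD N n b
    have h2 : (F.obj V).d (n + 1 + 1) (n + 1) (sD V N (n + 1) b) = b - (sS V (n + 1) ^ N) b -
      sD V N n ((F.obj V).d (n + 1) n b) := by
        rw [← sub_eq_of_eq_add this.symm]
    rw [h2, sD_map]
    have hy' : (F.map w).f n y = (F.obj V).d (n + 1) n b := hy
    rw [hy']
    abel

lemma d_d_apply (K : ChainComplex (ModuleCat.{0} ℤ) ℕ) (i j k : ℕ) (x : K.X i) :
    K.d j k (K.d i j x) = 0 :=
  congrArg (fun g => g.hom x) (K.d_comp_d i j k)

lemma relπ_F {A X : TopCat.{0}} (i : A ⟶ X) (n : ℕ) (x : (F.obj A).X n) :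
    (relπ i).f n ((F.map i).f n x) = 0 :=
  congrArg (fun g => (g.f n).hom x) (F_relπ i)

lemma excision (u : U ⟶ X) (v : V ⟶ X) (w1 : W ⟶ U) (w2 : W ⟶ V) (w : w2 ≫ v = w1 ≫ u)
    (hu : Topology.IsOpenEmbedding u.hom)
    (hv : Topology.IsOpenEmbedding v.hom) (hcov : ∀ x, x ∈ Set.range u.hom ∨ x ∈ Set.range v.hom)
    (hw : Topology.IsEmbedding w2.hom)
    (hW : ∀ (x : U) (y : V), u.hom x = v.hom y → ∃ z : W, w2.hom z = y) :
    QuasiIso (relMap w2 u w1 v w) := by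
  have : Mono u := (TopCat.mono_iff_injective _).2 hu.injective
  have : Mono v := (TopCat.mono_iff_injective _).2 hv.injective
  have : Mono w2 := (TopCat.mono_iff_injective _).2 hw.injective
  have hQ : ∀ n (b : (F.obj V).X n), (relMap w2 u w1 v w).f n ((relπ w2).f n b) =
      (relπ u).f n ((F.map v).f n b) := fun n b =>
    congrArg (fun g => (g.f n).hom b) (relπ_relMap w2 u w1 v w)
  have hInter := chain_inter u v w2 hv.isEmbedding hw hW
  apply quasiIso_of_elements
  · intro n z w' hz hw'
    obtain ⟨b, rfl⟩ := relπ_surj w2 n z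
    obtain ⟨e, rfl⟩ := relπ_surj u (n + 1) w'
    rw [hQ, comm_apply, ← sub_eq_zero, ← map_sub, relπ_eq_zero] at hw'
    obtain ⟨a0, ha0⟩ := hw'
    rw [comm_apply, relπ_eq_zero] at hz
    obtain ⟨N, a', b', he⟩ := small_chain u v hu hv hcov (n + 1) e
    obtain ⟨r, hr⟩ := sub_rel w2 N n b hz
    have h1 : (F.map v).f n ((sS V n ^ N) b - (F.obj V).d (n + 1) n b') =
        (F.map u).f n ((F.obj U).d (n + 1) n a' + (sS U n ^ N) a0) := by
      rw [map_sub, map_add, sSN_map, sSN_map, ha0, map_sub]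
      have h2 : (sS X n ^ N) ((F.obj X).d (n + 1) n e) =
          (F.obj X).d (n + 1) n ((sS X (n + 1) ^ N) e) := (cd_sSN N n e).symm
      rw [h2, he, map_add, comm_apply, comm_apply]
      abel
    obtain ⟨z, hz⟩ := hInter n _ _ h1.symm
    refine ⟨(relπ w2).f (n + 1) (sD V N n b + b'), ?_⟩
    rw [comm_apply, ← sub_eq_zero, ← map_sub, relπ_eq_zero]
    refine ⟨z + r, ?_⟩
    rw [map_add, hz, map_add]
    nth_rw 2 [hr]
    abel
  · intro n z hz
    obtain ⟨c, rfl⟩ := relπ_surj u n z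
    rw [comm_apply, relπ_eq_zero] at hz
    obtain ⟨N, a, b, hab⟩ := small_chain u v hu hv hcov n c
    obtain ⟨r, hr⟩ := sub_rel u N n c hz
    obtain ⟨y, hy⟩ := hz
    refine ⟨(relπ w2).f n b, (relπ u).f (n + 1) (sD X N n c), ?_, ?_⟩
    · rw [comm_apply, relπ_eq_zero]
      refine hInter (n - 1) (y - (F.obj U).d n (n - 1) (r + a)) _ ?_
      rw [map_sub, hy, ← comm_apply, ← comm_apply]
      have hr2 := congrArg ((F.obj X).d n (n - 1)) hr
      rw [map_add, map_add, d_d_apply, hab, map_add] at hr2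
      rw [hr2, map_add, map_add]
      abel
    · rw [hQ, comm_apply, ← map_add]
      have h3 : c = (F.map v).f n b + (F.obj X).d (n + 1) n (sD X N n c) +
          ((F.map u).f n r + (F.map u).f n a) := by
        nth_rw 1 [hr]
        rw [hab]
        abel
      nth_rw 1 [h3]
      rw [map_add, map_add _ ((F.map u).f n r), relπ_F, relπ_F]
      abel

end KEq

open CategoryTheory
namespace KEq
open Limits AlgebraicTopology HomologicalComplex

section
variable {E E' : Type} [TopologicalSpace E] [TopologicalSpace E']

noncomputable abbrev inc {A B : Set E} (h : A ⊆ B) : TopCat.of A ⟶ TopCat.of B :=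
  hom ⟨Set.inclusion h, continuous_inclusion h⟩

/-- Inclusion of a subset in the whole space. -/
noncomputable abbrev sub (A : Set E) : TopCat.of A ⟶ TopCat.of E :=
  hom ⟨Subtype.val, continuous_subtype_val⟩

instance inc_mono {A B : Set E} (h : A ⊆ B) : Mono (inc h) :=
  (TopCat.mono_iff_injective _).2 (Set.inclusion_injective h)

instance sub_mono (A : Set E) : Mono (sub A) :=
  (TopCat.mono_iff_injective _).2 Subtype.val_injective

lemma quasiIso_homeo (h : E ≃ₜ E') : QuasiIso (F.map (hom (h : C(E, E')))) := by
  refine quasiIso_homotopyEquiv _ (h.symm : C(E', E)) ?_ ?_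
  · rw [show ((h.symm : C(E', E)).comp (h : C(E, E'))) = ContinuousMap.id E by ext; simp]
  · rw [show ((h : C(E, E')).comp (h.symm : C(E', E))) = ContinuousMap.id E' by ext; simp]

lemma HB_homeo (h : E ≃ₜ E') {b : ℕ → ℕ} (hb : HB (F.obj (TopCat.of E)) b) :
    HB (F.obj (TopCat.of E')) b :=
  hb.of_quasiIso _ (quasiIso_homeo h)

/-- Homeomorphism invariance for pairs given by embeddings. -/
lemma HB_rel_homeo {A X B Y : Type} [TopologicalSpace A] [TopologicalSpace X] [TopologicalSpace B]
    [TopologicalSpace Y] (i : C(A, X)) (j : C(B, Y)) (hi : Function.Injective i)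
    (hj : Function.Injective j) (a : A ≃ₜ B) (x : X ≃ₜ Y) (w : ∀ z, x (i z) = j (a z)) {b : ℕ → ℕ}
    (hb : HB (rel (hom i)) b) : HB (rel (hom j)) b := by
  have : Mono (hom i) := (TopCat.mono_iff_injective _).2 hi
  have : Mono (hom j) := (TopCat.mono_iff_injective _).2 hj
  refine hb.of_quasiIso (relMap (hom i) (hom j) (hom (a : C(A, B))) (hom (x : C(X, Y))) ?_)
    (quasiIso_relMap _ _ _ _ _ (quasiIso_homeo a) (quasiIso_homeo x))
  ext z
  exact w z

lemma acyclic_rel {A X : TopCat.{0}} (i : A ⟶ X) [Mono i] (h : QuasiIso (F.map i)) :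
    (rel i).Acyclic := by
  have hS := pair_shortExact i
  intro n
  rw [exactAt_iff_isZero_homology]
  have hg : ∀ n, homologyMap (relπ i) n = 0 := by
    intro n
    have : IsIso (homologyMap (F.map i) n) := by
      rw [← quasiIsoAt_iff_isIso_homologyMap]; infer_instance
    rw [← cancel_epi (homologyMap (F.map i) n), ← homologyMap_comp, F_relπ, homologyMap_zero,
      comp_zero]
  rcases n with _ | n
  · have hz : Epi (homologyMap (relπ i) 0) := by
      have e : IsIso ((rel i).iCycles 0) := isIso_iCycles _ 0 0 (by simp) (by simp)
      have e2 : IsIso ((F.obj X).iCycles 0) := isIso_iCycles _ 0 0 (by simp) (by simp)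
      have h0 : Epi (cyclesMap (relπ i) 0) := by
        have : cyclesMap (relπ i) 0 =
            (F.obj X).iCycles 0 ≫ (relπ i).f 0 ≫ inv ((rel i).iCycles 0) := by
          rw [← cancel_mono ((rel i).iCycles 0)]
          simp
        rw [this]
        infer_instance
      have : Epi ((F.obj X).homologyπ 0 ≫ homologyMap (relπ i) 0) := by
        rw [homologyπ_naturality]
        infer_instance
      exact epi_of_epi ((F.obj X).homologyπ 0) _
    rw [IsZero.iff_id_eq_zero, ← cancel_epi (homologyMap (relπ i) 0)]
    rw [hg]
    simp
  · have hm : Mono (hS.δ (n + 1) n (rel_succ n)) :=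
      (hS.homology_exact₃ _ _ (rel_succ n)).mono_g (hg _)
    have : IsIso (homologyMap (F.map i) n) := by
      rw [← quasiIsoAt_iff_isIso_homologyMap]; infer_instance
    have hδ : hS.δ (n + 1) n (rel_succ n) = 0 := by
      rw [← cancel_mono (homologyMap (F.map i) n), zero_comp]
      exact hS.δ_comp (n + 1) n (rel_succ n)
    rw [IsZero.iff_id_eq_zero, ← cancel_mono (hS.δ (n + 1) n (rel_succ n)), hδ]
    simp

lemma homotopic_of_path {P Q : Type} [TopologicalSpace P] [TopologicalSpace Q] (f g : C(P, Q))
    (H : P → ℝ → Q) (hc : Continuous (fun p : P × unitInterval => H p.1 p.2))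
    (h0 : ∀ p, H p 0 = f p) (h1 : ∀ p, H p 1 = g p) : f.Homotopic g :=
  ⟨{ toFun := fun p => H p.2 p.1
     continuous_toFun := hc.comp continuous_swap
     map_zero_left := fun p => by simpa using h0 p
     map_one_left := fun p => by simpa using h1 p }⟩

end
end KEq

open CategoryTheory
namespace KEq
open Limits AlgebraicTopology HomologicalComplex

section
variable {E E' : Type} [TopologicalSpace E] [TopologicalSpace E']

lemma homotopic_sub {P : Type} [TopologicalSpace P] {A : Set E} (f g : C(P, A)) (H : P → ℝ → E)
    (hc : Continuous (fun p : P × ℝ => H p.1 p.2))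
    (hA : ∀ p s, 0 ≤ s → s ≤ 1 → H p s ∈ A)
    (h0 : ∀ p, H p 0 = f p) (h1 : ∀ p, H p 1 = g p) : f.Homotopic g :=
  ⟨{ toFun := fun p => ⟨H p.2 p.1, hA p.2 p.1 p.1.2.1 p.1.2.2⟩
     continuous_toFun := by
       refine Continuous.subtype_mk ?_ _
       exact hc.comp (continuous_snd.prodMk (continuous_subtype_val.comp continuous_fst))
     map_zero_left := fun p => by ext; simpa using h0 p
     map_one_left := fun p => by ext; simpa using h1 p }⟩

lemma HB_suspension {A : Set E} (hA : IsOpen A) {b : ℕ → ℕ} (hb : HB (rel (sub A)) b) :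
    HB (rel (sub {p : E × ℝ | p.1 ∈ A ∨ p.2 ≠ 0})) (fun n => if n = 0 then 0 else b (n - 1)) := by
  set T : Set (E × ℝ) := {p : E × ℝ | p.1 ∈ A ∨ p.2 ≠ 0} with hT
  set Um : Set (E × ℝ) := {p : E × ℝ | p.1 ∈ A ∨ p.2 < 0} with hUm
  set Up : Set (E × ℝ) := {p : E × ℝ | p.1 ∈ A ∨ 0 < p.2} with hUp
  set W : Set (E × ℝ) := {p : E × ℝ | p.1 ∈ A} with hW
  have oA : IsOpen W := hA.preimage continuous_fst
  have oUm : IsOpen Um := oA.union (isOpen_lt continuous_snd continuous_const)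
  have oUp : IsOpen Up := oA.union (isOpen_lt continuous_const continuous_snd)
  have hmT : Um ⊆ T := fun p hp => hp.imp id (fun h => h.ne)
  have hpT : Up ⊆ T := fun p hp => hp.imp id (fun h => h.ne')
  have hWm : W ⊆ Um := fun p hp => Or.inl hp
  have hWp : W ⊆ Up := fun p hp => Or.inl hp
  -- acyclicity of the middle term
  have q1 : QuasiIso (F.map (sub Um)) := by
    refine quasiIso_homotopyEquiv _
      (⟨fun p => ⟨(p.1, -1), Or.inr (by norm_num)⟩, by fun_prop⟩ : C(E × ℝ, Um)) ?_ ?_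
    · refine homotopic_sub _ _ (fun p s => (p.1.1, (1 - s) * (-1) + s * p.1.2)) (by fun_prop) ?_ ?_ ?_
      · rintro ⟨p, hp⟩ s h0 h1
        refine hp.imp id fun h => ?_
        simp only
        by_cases hs : s = 0
        · simp [hs]
        · have : 0 < s := lt_of_le_of_ne h0 (Ne.symm hs)
          nlinarith [mul_pos_of_neg_of_neg h (neg_lt_zero.2 this)]
      · intro p; simp
      · intro p; simp
    · refine homotopic_of_path _ _ (fun p s => (p.1, (1 - s) * (-1) + s * p.2)) (by fun_prop) ?_ ?_
      · intro p; simp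
      · intro p; simp
  have a1 := acyclic_rel _ q1
  have ex := excision (inc hmT) (inc hpT) (inc hWm) (inc hWp) rfl
    (Topology.IsOpenEmbedding.inclusion (hmT) (oUm.preimage continuous_subtype_val))
    (Topology.IsOpenEmbedding.inclusion (hpT) (oUp.preimage continuous_subtype_val)) (by
      rintro ⟨p, hp⟩
      have : p ∈ Um ∨ p ∈ Up := by
        rcases hp with h | h
        · exact Or.inl (Or.inl h)
        · rcases lt_or_gt_of_ne h with h | h
          · exact Or.inl (Or.inr h)
          · exact Or.inr (Or.inr h)
      refine this.imp (fun h => ⟨⟨p, h⟩, rfl⟩) (fun h => ⟨⟨p, h⟩, rfl⟩))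
    (Topology.IsEmbedding.inclusion hWp) (by
      rintro ⟨p, hp⟩ ⟨q, hq⟩ h
      have h' : p = q := congrArg Subtype.val h
      subst h'
      refine ⟨⟨p, ?_⟩, rfl⟩
      rcases hp with hp | hp
      · exact hp
      · rcases hq with hq | hq
        · exact hq
        · exact absurd hp (not_lt.2 hq.le))
  -- projection
  have q2 : QuasiIso (F.map (hom (⟨fun p => p.1.1, by fun_prop⟩ : C(Up, E)))) := by
    refine quasiIso_homotopyEquiv _
      (⟨fun x => ⟨(x, 1), Or.inr (by norm_num)⟩, by fun_prop⟩ : C(E, Up)) ?_ ?_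
    · refine homotopic_sub _ _ (fun p s => (p.1.1, (1 - s) * 1 + s * p.1.2)) (by fun_prop) ?_ ?_ ?_
      · rintro ⟨p, hp⟩ s h0 h1
        refine hp.imp id fun h => ?_
        simp only
        by_cases h : s = 0
        · simp [h]
        · have : 0 < s := lt_of_le_of_ne h0 (Ne.symm h)
          nlinarith [mul_pos this ‹0 < p.2›]
      · intro p; simp
      · intro p; simp
    · exact ContinuousMap.Homotopic.refl _
  have q3 : QuasiIso (F.map (hom (⟨fun p => ⟨p.1.1, p.2⟩, by fun_prop⟩ : C(W, A)))) := by
    refine quasiIso_homotopyEquiv _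
      (⟨fun x => ⟨(x.1, 1), x.2⟩, by fun_prop⟩ : C(A, W)) ?_ ?_
    · refine homotopic_sub _ _ (fun p s => (p.1.1, (1 - s) * 1 + s * p.1.2)) (by fun_prop) ?_ ?_ ?_
      · rintro ⟨p, hp⟩ s h0 h1
        exact hp
      · intro p; simp
      · intro p; simp
    · exact ContinuousMap.Homotopic.refl _
  have q4 := quasiIso_relMap (inc hWp) (sub A)
    (hom (⟨fun p => ⟨p.1.1, p.2⟩, by fun_prop⟩ : C(W, A)))
    (hom (⟨fun p => p.1.1, by fun_prop⟩ : C(Up, E))) rfl q3 q2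
  have h1 : HB (rel (inc hmT)) b := (hb.of_quasiIso' _ q4).of_quasiIso _ ex
  exact HB.shift (triple_shortExact (inc hmT) (sub T)) a1 h1

lemma HB.congr {K : ChainComplex (ModuleCat.{0} ℤ) ℕ} {b b' : ℕ → ℕ} (h : HB K b)
    (e : ∀ n, b n = b' n) : HB K b' := by
  rwa [← funext e]

lemma HB_sub_homeo {A : Set E} {B : Set E'} (x : E ≃ₜ E') (h : ∀ z, z ∈ A ↔ x z ∈ B) {b : ℕ → ℕ}
    (hb : HB (rel (sub A)) b) : HB (rel (sub B)) b :=
  HB_rel_homeo _ _ Subtype.val_injective Subtype.val_injective (x.subtype h) x (fun _ => rfl) hb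

lemma empty_zero (n : ℕ) (x : (F.obj (TopCat.of (∅ : Set E))).X n) : x = 0 := by
  have := chain_ext (X := TopCat.of (∅ : Set E)) (n := n) (f := LinearMap.id) (g := 0) (by
    intro σ
    exact (σ (Classical.arbitrary _)).2.elim)
  exact this x

lemma HB_base {b : ℕ → ℕ} (hb : HB (F.obj (TopCat.of E)) b) : HB (rel (sub (∅ : Set E))) b := by
  have : ∀ n, IsIso ((relπ (sub (∅ : Set E))).f n) := by
    intro n
    rw [ConcreteCategory.isIso_iff_bijective]
    refine ⟨?_, relπ_surj _ n⟩
    rw [injective_iff_map_eq_zero]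
    intro x hx
    obtain ⟨y, hy⟩ := (relπ_eq_zero _ n x).1 hx
    rw [← hy, empty_zero n y, map_zero]
  have : IsIso (relπ (sub (∅ : Set E))) := HomologicalComplex.Hom.isIso_of_components _
  exact hb.of_quasiIso (relπ (sub (∅ : Set E))) inferInstance

lemma HB_vec_fin {b : ℕ → ℕ} (hb : HB (F.obj (TopCat.of E)) b) (m : ℕ) :
    HB (rel (sub {p : E × (Fin m → ℝ) | p.2 ≠ 0})) (fun n => if n < m then 0 else b (n - m)) := by
  induction m with
  | zero =>
    have e : (∅ : Set (E × (Fin 0 → ℝ))) = {p : E × (Fin 0 → ℝ) | p.2 ≠ 0} := by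
      ext p; simp [Subsingleton.elim p.2 0]
    rw [← e]
    refine HB_base (HB_homeo (Homeomorph.prodUnique E (Fin 0 → ℝ)).symm (hb.congr ?_))
    intro n; simp
  | succ m ih =>
    let x : (E × (Fin m → ℝ)) × ℝ ≃ₜ E × (Fin (m + 1) → ℝ) :=
      { toFun := fun p => (p.1.1, Fin.cons p.2 p.1.2)
        invFun := fun p => ((p.1, Fin.tail p.2), p.2 0)
        left_inv := fun p => by simp
        right_inv := fun p => by simp
        continuous_toFun := by fun_prop
        continuous_invFun := by unfold Fin.tail; fun_prop }
    have o : IsOpen {p : E × (Fin m → ℝ) | p.2 ≠ 0} :=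
      isOpen_ne_fun continuous_snd continuous_const
    refine (HB_sub_homeo x ?_ (HB_suspension o ih)).congr ?_
    · intro p
      simp only [Set.mem_ofPred_eq, x, ne_eq, funext_iff, Fin.forall_fin_succ]
      simp
      tauto
    · intro n
      rcases n with _ | n
      · simp
      · simp

lemma HB_vec {S : Type} [Fintype S] {b : ℕ → ℕ} (hb : HB (F.obj (TopCat.of E)) b) :
    HB (rel (sub {p : E × (S → ℝ) | p.2 ≠ 0}))
      (fun n => if n < Fintype.card S then 0 else b (n - Fintype.card S)) := by
  refine HB_sub_homeo ((Homeomorph.refl E).prodCongr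
    (Homeomorph.piCongrLeft (Y := fun _ => ℝ) (Fintype.equivFin S).symm)) ?_ (HB_vec_fin hb _)
  intro p
  refine not_congr ?_
  constructor
  · intro h
    ext s
    simp [h, Homeomorph.piCongrLeft, Equiv.piCongrLeft]
  · intro h
    ext s
    have := congrFun h ((Fintype.equivFin S).symm s)
    simpa [h, Homeomorph.piCongrLeft, Equiv.piCongrLeft] using this

end
end KEq

open CategoryTheory
namespace KEq
open Limits AlgebraicTopology HomologicalComplex

section
variable {E : Type} [TopologicalSpace E]

lemma excision_sets {U V W : Set E} (hU : IsOpen U) (hV : IsOpen V) (hWU : W ⊆ U) (hWV : W ⊆ V)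
    (hW : U ∩ V ⊆ W) {X : Set E} (hUX : U ⊆ X) (hVX : V ⊆ X) (hX : X ⊆ U ∪ V) :
    QuasiIso (relMap (inc hWV) (inc hUX) (inc hWU) (inc hVX) rfl) := by
  refine excision (inc hUX) (inc hVX) (inc hWU) (inc hWV) rfl
    (Topology.IsOpenEmbedding.inclusion (hUX) (hU.preimage continuous_subtype_val))
    (Topology.IsOpenEmbedding.inclusion (hVX) (hV.preimage continuous_subtype_val)) ?_
    (Topology.IsEmbedding.inclusion hWV) ?_
  · rintro ⟨p, hp⟩
    exact (hX hp).imp (fun h => ⟨⟨p, h⟩, rfl⟩) (fun h => ⟨⟨p, h⟩, rfl⟩)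
  · rintro ⟨p, hp⟩ ⟨q, hq⟩ h
    have h' : p = q := congrArg Subtype.val h
    subst h'
    exact ⟨⟨p, hW ⟨hp, hq⟩⟩, rfl⟩

lemma acyclic_HB {K : ChainComplex (ModuleCat.{0} ℤ) ℕ} (h : K.Acyclic) : HB K (fun _ => 0) :=
  fun n => FR_zero (h n).isZero_homology

lemma HB_rel_congr {A B A' B' : Set E} (hA : A = A') (hB : B = B') (h : A ⊆ B) (h' : A' ⊆ B')
    {b : ℕ → ℕ} (hb : HB (rel (inc h)) b) : HB (rel (inc h')) b := by
  subst hA hB; exact hb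

lemma epi_triple {A T X V Z : TopCat.{0}} (i : A ⟶ T) (j : T ⟶ X) (a : Z ⟶ A) (v : V ⟶ X)
    (z : Z ⟶ V) (w : z ≫ v = a ≫ (i ≫ j)) (w' : z ≫ v = (a ≫ i) ≫ j)
    (h : QuasiIso (relMap z j (a ≫ i) v w')) (n : ℕ) : Epi (homologyMap (tripleSC i j).g n) := by
  have e : relMap z (i ≫ j) a v w ≫ (tripleSC i j).g = relMap z j (a ≫ i) v w' := by
    rw [← cancel_epi (relπ z)]
    simp [relπ_relMap_assoc, tripleSC]
  have : IsIso (homologyMap (relMap z (i ≫ j) a v w ≫ (tripleSC i j).g) n) := by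
    rw [e, ← quasiIsoAt_iff_isIso_homologyMap]; infer_instance
  rw [homologyMap_comp] at this
  exact epi_of_epi (homologyMap (relMap z (i ≫ j) a v w) n) _

lemma HB_union {γ : Type} [DecidableEq γ] {U : Set E} (hU : IsOpen U) {V : γ → Set E}
    (hV : ∀ g, IsOpen (V g)) (hd : ∀ g g', g ≠ g' → V g ∩ V g' ⊆ U) {b : γ → ℕ → ℕ}
    (hb : ∀ g, HB (rel (inc (Set.inter_subset_left : V g ∩ U ⊆ V g))) (b g)) (s : Finset γ) :
    HB (rel (inc (Set.subset_union_left : U ⊆ U ∪ ⋃ g ∈ s, V g))) (fun n => ∑ g ∈ s, b g n) := by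
  induction s using Finset.induction_on with
  | empty =>
    have h : (rel (inc (Set.Subset.refl U))).Acyclic := by
      refine acyclic_rel _ ?_
      have : inc (Set.Subset.refl U) = 𝟙 _ := rfl
      rw [this, F.map_id]
      infer_instance
    exact (HB_rel_congr rfl (by simp) _ _ (acyclic_HB h)).congr (by simp)
  | insert g s hg ih =>
    set W := U ∪ ⋃ g ∈ s, V g with hW
    have oW : IsOpen W := hU.union (isOpen_biUnion fun g _ => hV g)
    set W' := U ∪ ⋃ x ∈ insert g s, V x with hW'
    have hUW : U ⊆ W := Set.subset_union_left
    have eW : W' = W ∪ V g := by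
      rw [hW', hW, Finset.set_biUnion_insert, Set.union_assoc, Set.union_comm (V g)]
    have hWW : W ⊆ W' := eW ▸ Set.subset_union_left
    have hVW : V g ⊆ W' := eW ▸ Set.subset_union_right
    have hi : W ∩ V g ⊆ V g ∩ U := by
      rintro x ⟨h1 | h1, h2⟩
      · exact ⟨h2, h1⟩
      · simp only [Set.mem_iUnion] at h1
        obtain ⟨g', hg', h1⟩ := h1
        exact ⟨h2, hd g g' (fun h => hg (h ▸ hg')) ⟨h2, h1⟩⟩
    have ex := excision_sets oW (hV g) (Set.inter_subset_right.trans hUW)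
      (Set.inter_subset_left : V g ∩ U ⊆ V g) hi hWW hVW eW.le
    have h3 := (hb g).of_quasiIso _ ex
    refine (HB.mid (triple_shortExact (inc hUW) (inc hWW)) ?_ ih h3).congr ?_
    · intro n
      exact epi_triple (inc hUW) (inc hWW) (inc Set.inter_subset_right) (inc hVW)
        (inc Set.inter_subset_left) rfl rfl ex n
    · intro n
      rw [Finset.sum_insert hg, add_comm]

end
end KEq

open CategoryTheory
namespace KEq
open Limits AlgebraicTopology HomologicalComplex

section
set_option linter.unusedSectionVars false
open Classical

/-- No `k` coordinates of the same colour are equal. -/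
def Mk {ι κ : Type} (k : ℕ) (c : ι → κ) : Set (ι → ℝ) :=
  {x | ∀ S : Finset ι, S.card = k → (∀ i ∈ S, ∀ j ∈ S, c i = c j) →
    ¬ (∀ i ∈ S, ∀ j ∈ S, x i = x j)}

lemma Mk_open {ι κ : Type} [Finite ι] (k : ℕ) (c : ι → κ) : IsOpen (Mk k c) := by
  have : Mk k c = ⋂ S : Finset ι, {x | S.card = k → (∀ i ∈ S, ∀ j ∈ S, c i = c j) →
    ¬ (∀ i ∈ S, ∀ j ∈ S, x i = x j)} := by
    ext x; simp [Mk]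
  rw [this]
  refine isOpen_iInter_of_finite fun S => ?_
  by_cases h1 : S.card = k
  · by_cases h2 : ∀ i ∈ S, ∀ j ∈ S, c i = c j
    · have : {x : ι → ℝ | S.card = k → (∀ i ∈ S, ∀ j ∈ S, c i = c j) →
        ¬ (∀ i ∈ S, ∀ j ∈ S, x i = x j)} = (⋂ i ∈ S, ⋂ j ∈ S, {x | x i = x j})ᶜ := by
        ext x
        refine ⟨fun h h' => h h1 h2 (by simpa using h'), fun h _ _ h' => h (by simpa using h')⟩
      rw [this]
      refine IsClosed.isOpen_compl (self := ?_)
      refine isClosed_biInter fun i _ => isClosed_biInter fun j _ => ?_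
      exact isClosed_eq (continuous_apply i) (continuous_apply j)
    · simp [h2]
  · simp [h1]

variable {ι κ : Type} [Fintype ι]

/-- Points all of whose coordinates but the new one satisfy the conditions. -/
def Xk (k : ℕ) (c : Option ι → κ) : Set (Option ι → ℝ) :=
  {x | (fun i => x (some i)) ∈ Mk k (fun i => c (some i))}

lemma Xk_open (k : ℕ) (c : Option ι → κ) : IsOpen (Xk k c) :=
  (Mk_open k (fun i => c (some i))).preimage (f := fun (x : Option ι → ℝ) i => x (some i)) (by fun_prop)

lemma Mk_sub_Xk (k : ℕ) (c : Option ι → κ) : Mk k c ⊆ Xk k c := by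
  intro x hx S hS hc h
  refine hx (S.map Function.Embedding.some) (by simpa using hS) ?_ ?_
  · simpa using hc
  · simpa using h

lemma not_Mk {k : ℕ} {c : Option ι → κ} {x : Option ι → ℝ} (hx : x ∈ Xk k c)
    (h : x ∉ Mk k c) : ∃ T : Finset ι, T.card + 1 = k ∧ (∀ i ∈ T, c (some i) = c none) ∧
      ∀ i ∈ T, x (some i) = x none := by
  obtain ⟨S, hS, hc, h⟩ : ∃ S : Finset (Option ι), S.card = k ∧ (∀ i ∈ S, ∀ j ∈ S, c i = c j) ∧
      (∀ i ∈ S, ∀ j ∈ S, x i = x j) := by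
    by_contra hn
    exact h fun S h1 h2 h3 => hn ⟨S, h1, h2, h3⟩
  have hn : none ∈ S := by
    by_contra hn
    have e : S = (S.eraseNone).map Function.Embedding.some := by
      rw [Finset.map_some_eraseNone, Finset.erase_eq_of_notMem hn]
    rw [e] at hS hc h
    refine hx S.eraseNone (by rwa [Finset.card_map] at hS) ?_ ?_
    · intro i hi j hj
      exact hc _ (Finset.mem_map_of_mem _ hi) _ (Finset.mem_map_of_mem _ hj)
    · intro i hi j hj
      exact h _ (Finset.mem_map_of_mem _ hi) _ (Finset.mem_map_of_mem _ hj)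
  refine ⟨S.eraseNone, ?_, ?_, ?_⟩
  · have := congrArg Finset.card (Finset.map_some_eraseNone S)
    rw [Finset.card_map, Finset.card_erase_of_mem hn] at this
    have := Finset.card_pos.2 ⟨_, hn⟩
    omega
  · intro i hi
    exact hc _ (Finset.mem_eraseNone.1 hi) _ hn
  · intro i hi
    exact h _ (Finset.mem_eraseNone.1 hi) _ hn

lemma not_Mk' {k : ℕ} {c : Option ι → κ} {x : Option ι → ℝ} (T : Finset ι) (h1 : T.card + 1 = k)
    (h2 : ∀ i ∈ T, c (some i) = c none) (h3 : ∀ i ∈ T, x (some i) = x none) : x ∉ Mk k c := by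
  intro h
  refine h (Finset.insertNone T) (by simpa using h1) ?_ ?_
  · have : ∀ i ∈ Finset.insertNone T, c i = c none := by
      rintro (_ | i) hi
      · rfl
      · exact h2 i (by simpa using hi)
    intro i hi j hj
    rw [this i hi, this j hj]
  · have : ∀ i ∈ Finset.insertNone T, x i = x none := by
      rintro (_ | i) hi
      · rfl
      · exact h3 i (by simpa using hi)
    intro i hi j hj
    rw [this i hi, this j hj]

/-- The admissible indices for the pieces. -/
def Gam (k : ℕ) (c : Option ι → κ) : Type :=
  {g : Finset ι × Finset ι // g.1.card + 1 = k ∧ Disjoint g.1 g.2 ∧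
    (∀ i ∈ g.1, c (some i) = c none) ∧ ∀ i ∈ g.2, c (some i) = c none}

noncomputable instance (k : ℕ) (c : Option ι → κ) : Fintype (Gam k c) := by
  unfold Gam; infer_instance

/-- The radius. -/
noncomputable def rad (S : Finset ι) (x : Option ι → ℝ) : ℝ := ∑ s ∈ S, |x (some s) - x none|

lemma rad_cont (S : Finset ι) : Continuous (rad S) := by
  unfold rad; fun_prop

lemma rad_bound (S : Finset ι) (x : Option ι → ℝ) {s : ι} (hs : s ∈ S) :
    x none - rad S x ≤ x (some s) ∧ x (some s) ≤ x none + rad S x := by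
  have : |x (some s) - x none| ≤ rad S x :=
    Finset.single_le_sum (f := fun s => |x (some s) - x none|) (fun _ _ => abs_nonneg _) hs
  rw [abs_le] at this
  constructor <;> linarith

lemma rad_nonneg (S : Finset ι) (x : Option ι → ℝ) : 0 ≤ rad S x :=
  Finset.sum_nonneg fun _ _ => abs_nonneg _

/-- The pieces. -/
def Vk (k : ℕ) (c : Option ι → κ) (g : Gam k c) : Set (Option ι → ℝ) :=
  Xk k c ∩ {x | (∀ a ∈ g.1.2, x (some a) < x none - rad g.1.1 x) ∧
    ∀ b, c (some b) = c none → b ∉ g.1.1 → b ∉ g.1.2 → x none + rad g.1.1 x < x (some b)}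

lemma Vk_open (k : ℕ) (c : Option ι → κ) (g : Gam k c) : IsOpen (Vk k c g) := by
  refine (Xk_open k c).inter ?_
  have hr := rad_cont g.1.1
  have : {x : Option ι → ℝ | (∀ a ∈ g.1.2, x (some a) < x none - rad g.1.1 x) ∧
    ∀ b, c (some b) = c none → b ∉ g.1.1 → b ∉ g.1.2 → x none + rad g.1.1 x < x (some b)} =
    (⋂ a ∈ g.1.2, {x : Option ι → ℝ | x (some a) < x none - rad g.1.1 x}) ∩
    ⋂ b ∈ {b | c (some b) = c none ∧ b ∉ g.1.1 ∧ b ∉ g.1.2},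
      {x : Option ι → ℝ | x none + rad g.1.1 x < x (some b)} := by
    ext x; simp
  rw [this]
  refine IsOpen.inter ?_ ?_
  · exact isOpen_biInter_finset fun a _ => isOpen_lt (by fun_prop) (by fun_prop)
  · exact (Set.toFinite _).isOpen_biInter fun a _ => isOpen_lt (by fun_prop) (by fun_prop)

lemma Vk_eq {k : ℕ} {c : Option ι → κ} {g : Gam k c} {x : Option ι → ℝ} (hx : x ∈ Vk k c g)
    (T : Finset ι) (h1 : T.card + 1 = k)
    (h2 : ∀ i ∈ T, c (some i) = c none) (h3 : ∀ i ∈ T, x (some i) = x none) :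
    T = g.1.1 ∧ g.1.2 = Finset.univ.filter (fun i => c (some i) = c none ∧ x (some i) < x none) := by
  have hr := rad_nonneg g.1.1 x
  have hT : T = g.1.1 := by
    refine Finset.eq_of_subset_of_card_le ?_ ?_
    · intro t ht
      by_contra hs
      by_cases ha : t ∈ g.1.2
      · have := hx.2.1 t ha
        rw [h3 t ht] at this
        linarith
      · have := hx.2.2 t (h2 t ht) hs ha
        rw [h3 t ht] at this
        linarith
    · have := g.2.1
      omega
  refine ⟨hT, ?_⟩
  ext i
  simp only [Finset.mem_filter, Finset.mem_univ, true_and]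
  constructor
  · intro hi
    refine ⟨g.2.2.2.2 i hi, ?_⟩
    have := hx.2.1 i hi
    linarith
  · rintro ⟨hc, hi⟩
    by_contra ha
    by_cases hs : i ∈ g.1.1
    · have := h3 i (hT ▸ hs)
      linarith
    · have := hx.2.2 i hc hs ha
      linarith

lemma Vk_disj {k : ℕ} {c : Option ι → κ} (g g' : Gam k c) (hg : g ≠ g') :
    Vk k c g ∩ Vk k c g' ⊆ Mk k c := by
  rintro x ⟨h, h'⟩
  by_contra hx
  obtain ⟨T, h1, h2, h3⟩ := not_Mk h.1 hx
  have e := Vk_eq h T h1 h2 h3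
  have e' := Vk_eq h' T h1 h2 h3
  exact hg (Subtype.ext (Prod.ext (e.1.symm.trans e'.1) (e.2.trans e'.2.symm)))

lemma Vk_cover {k : ℕ} {c : Option ι → κ} {x : Option ι → ℝ} (hx : x ∈ Xk k c) (h : x ∉ Mk k c) :
    ∃ g, x ∈ Vk k c g := by
  obtain ⟨T, h1, h2, h3⟩ := not_Mk hx h
  refine ⟨⟨(T, Finset.univ.filter (fun i => c (some i) = c none ∧ x (some i) < x none)),
    h1, ?_, h2, ?_⟩, hx, ?_, ?_⟩
  · rw [Finset.disjoint_left]
    intro i hi hi'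
    have := (Finset.mem_filter.1 hi').2.2
    rw [h3 i hi] at this
    exact lt_irrefl _ this
  · intro i hi
    exact (Finset.mem_filter.1 hi).2.1
  all_goals
    have hr : rad T x = 0 := Finset.sum_eq_zero fun i hi => by simp [h3 i hi]
  · intro a ha
    have := (Finset.mem_filter.1 ha).2.2
    simp only [hr]
    linarith
  · intro b hb hbT hbA
    simp only at hbT hbA
    simp only [hr, add_zero]
    have h4 : x none ≤ x (some b) := by
      by_contra h4
      exact hbA (Finset.mem_filter.2 ⟨Finset.mem_univ _, hb, not_le.1 h4⟩)
    refine lt_of_le_of_ne h4 fun h5 => ?_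
    refine hx (insert b T) (by rw [Finset.card_insert_of_notMem hbT, h1]) ?_ ?_
    · have : ∀ i ∈ insert b T, c (some i) = c none := by
        intro i hi
        rcases Finset.mem_insert.1 hi with rfl | hi
        · exact hb
        · exact h2 i hi
      intro i hi j hj
      exact (this i hi).trans (this j hj).symm
    · have : ∀ i ∈ insert b T, x (some i) = x none := by
        intro i hi
        rcases Finset.mem_insert.1 hi with rfl | hi
        · exact h5.symm
        · exact h3 i hi
      intro i hi j hj
      exact (this i hi).trans (this j hj).symm

lemma Vk_mem_Mk {k : ℕ} {c : Option ι → κ} {g : Gam k c} {x : Option ι → ℝ} (hx : x ∈ Vk k c g) :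
    x ∈ Mk k c ↔ ∃ s ∈ g.1.1, x (some s) ≠ x none := by
  constructor
  · intro h
    by_contra hs
    push Not at hs
    exact not_Mk' g.1.1 g.2.1 g.2.2.2.1 hs h
  · rintro ⟨s, hs, h⟩
    by_contra hm
    obtain ⟨T, h1, h2, h3⟩ := not_Mk hx.1 hm
    exact h (h3 s ((Vk_eq hx T h1 h2 h3).1 ▸ hs))

/-- The new colouring. -/
noncomputable def cg (k : ℕ) (c : Option ι → κ) (g : Gam k c) : {i // i ∉ g.1.1} → Option κ :=
  fun i => if c (some i) = c none ∧ i.1 ∉ g.1.2 then none else some (c (some i))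

lemma core {k : ℕ} {c : Option ι → κ} {g : Gam k c} {x : Option ι → ℝ}
    (hx : (∀ a ∈ g.1.2, x (some a) < x none - rad g.1.1 x) ∧
    ∀ b, c (some b) = c none → b ∉ g.1.1 → b ∉ g.1.2 → x none + rad g.1.1 x < x (some b))
    (z : {i // i ∉ g.1.1} → ℝ)
    (hz : ∀ i i', cg k c g i = cg k c g i' → (z i = z i' ↔ x (some i) = x (some i'))) :
    x ∈ Xk k c ↔ z ∈ Mk k (cg k c g) := by
  have hr := rad_nonneg g.1.1 x
  constructor
  · intro h T hT hc hT'
    refine h (T.map (Function.Embedding.subtype _)) (by simpa using hT) ?_ ?_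
    · intro i hi j hj
      obtain ⟨i, hi', rfl⟩ := Finset.mem_map.1 hi
      obtain ⟨j, hj', rfl⟩ := Finset.mem_map.1 hj
      have := hc i hi' j hj'
      unfold cg at this
      split_ifs at this with h1 h2
      · exact h1.1.trans h2.1.symm
      · exact Option.some_injective _ this
    · intro i hi j hj
      obtain ⟨i, hi', rfl⟩ := Finset.mem_map.1 hi
      obtain ⟨j, hj', rfl⟩ := Finset.mem_map.1 hj
      exact (hz i j (hc i hi' j hj')).1 (hT' i hi' j hj')
  · intro h T hT hc hT'
    have hS : ∀ i ∈ T, i ∉ g.1.1 := by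
      intro s hsT hs
      obtain ⟨t, ht, hts⟩ : ∃ t ∈ T, t ∉ g.1.1 := by
        by_contra hn
        push Not at hn
        have := Finset.card_le_card (show T ⊆ g.1.1 from hn)
        have := g.2.1
        omega
      have hb := rad_bound g.1.1 x hs
      have e : x (some s) = x (some t) := hT' s hsT t ht
      have ec : c (some s) = c (some t) := hc s hsT t ht
      by_cases ha : t ∈ g.1.2
      · have := hx.1 t ha
        linarith
      · have := hx.2 t (ec.symm.trans (g.2.2.2.1 s hs)) hts ha
        linarith
    have key : ∀ i ∈ T, ∀ j ∈ T, c (some i) = c none → i ∈ g.1.2 → j ∈ g.1.2 := by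
      intro i hi j hj hci hia
      by_contra hja
      have ec : c (some i) = c (some j) := hc i hi j hj
      have e : x (some i) = x (some j) := hT' i hi j hj
      have h1 := hx.1 i hia
      have h2 := hx.2 j (ec.symm.trans hci) (hS j hj) hja
      linarith
    have hcg : ∀ i j : {i // i ∉ g.1.1}, i.1 ∈ T → j.1 ∈ T → cg k c g i = cg k c g j := by
      intro i j hi hj
      have ec : c (some i.1) = c (some j.1) := hc i hi j hj
      unfold cg
      rw [ec]
      by_cases hcj : c (some j.1) = c none
      · have : i.1 ∈ g.1.2 ↔ j.1 ∈ g.1.2 :=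
          ⟨key i hi j hj (ec.trans hcj), key j hj i hi hcj⟩
        simp [this]
      · simp [hcj]
    refine h (T.subtype _) ?_ ?_ ?_
    · rw [Finset.card_subtype, Finset.filter_true_of_mem hS, hT]
    · intro i hi j hj
      rw [Finset.mem_subtype] at hi hj
      exact hcg i j hi hj
    · intro i hi j hj
      rw [Finset.mem_subtype] at hi hj
      exact (hz i j (hcg i j hi hj)).2 (hT' i hi j hj)

end
end KEq

open CategoryTheory
namespace KEq
open Limits AlgebraicTopology HomologicalComplex

section
set_option linter.unusedSectionVars false
open Classical
variable {ι κ : Type} [Fintype ι]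

/-- Forward coordinates. -/
noncomputable def zf (k : ℕ) (c : Option ι → κ) (g : Gam k c) (x : Option ι → ℝ) :
    {i // i ∉ g.1.1} → ℝ := fun i =>
  if i.1 ∈ g.1.2 then - Real.log (x none - rad g.1.1 x - x (some i)) else
    if c (some i) = c none then Real.log (x (some i) - (x none + rad g.1.1 x)) else x (some i)

/-- Backward coordinates. -/
noncomputable def xb (k : ℕ) (c : Option ι → κ) (g : Gam k c) (z : {i // i ∉ g.1.1} → ℝ) (y : ℝ)
    (v : g.1.1 → ℝ) : Option ι → ℝ := fun o => o.elim y fun i =>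
  if h : i ∈ g.1.1 then y + v ⟨i, h⟩ else
    if i ∈ g.1.2 then y - ∑ s, |v s| - Real.exp (- z ⟨i, h⟩) else
    if c (some i) = c none then y + ∑ s, |v s| + Real.exp (z ⟨i, h⟩) else z ⟨i, h⟩

lemma xb_rad (k : ℕ) (c : Option ι → κ) (g : Gam k c) (z : {i // i ∉ g.1.1} → ℝ) (y : ℝ)
    (v : g.1.1 → ℝ) : rad g.1.1 (xb k c g z y v) = ∑ s, |v s| := by
  unfold rad
  rw [← Finset.sum_coe_sort]
  refine Finset.sum_congr rfl fun s _ => ?_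
  simp [xb]

lemma xb_ineq (k : ℕ) (c : Option ι → κ) (g : Gam k c) (z : {i // i ∉ g.1.1} → ℝ) (y : ℝ)
    (v : g.1.1 → ℝ) : (∀ a ∈ g.1.2, xb k c g z y v (some a) < xb k c g z y v none - rad g.1.1 (xb k c g z y v)) ∧
    ∀ b, c (some b) = c none → b ∉ g.1.1 → b ∉ g.1.2 →
      xb k c g z y v none + rad g.1.1 (xb k c g z y v) < xb k c g z y v (some b) := by
  rw [xb_rad]
  constructor
  · intro a ha
    have hs : a ∉ g.1.1 := fun h => Finset.disjoint_left.1 g.2.2.1 h ha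
    simp [xb, hs, ha, Real.exp_pos]
  · intro b hb hs ha
    simp [xb, hs, ha, hb, Real.exp_pos]

lemma zf_xb (k : ℕ) (c : Option ι → κ) (g : Gam k c) (z : {i // i ∉ g.1.1} → ℝ) (y : ℝ)
    (v : g.1.1 → ℝ) : zf k c g (xb k c g z y v) = z := by
  ext ⟨i, hi⟩
  unfold zf
  rw [xb_rad]
  by_cases ha : i ∈ g.1.2
  · simp [xb, hi, ha]
  · by_cases hc : c (some i) = c none
    · simp [xb, hi, ha, hc]
    · simp [xb, hi, ha, hc]

lemma xb_zf (k : ℕ) (c : Option ι → κ) (g : Gam k c) (x : Option ι → ℝ) (hx : x ∈ Vk k c g) :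
    xb k c g (zf k c g x) (x none) (fun s => x (some s) - x none) = x := by
  have hr : ∑ s : g.1.1, |x (some s.1) - x none| = rad g.1.1 x := by
    unfold rad
    exact Finset.sum_coe_sort g.1.1 (fun s => |x (some s) - x none|)
  ext (_ | i)
  · rfl
  · simp only [xb, Option.elim, hr, zf]
    by_cases hs : i ∈ g.1.1
    · simp [hs]
    · by_cases ha : i ∈ g.1.2
      · have := hx.2.1 i ha
        simp [hs, ha, Real.exp_log (show 0 < x none - rad g.1.1 x - x (some i) by linarith)]
      · by_cases hc : c (some i) = c none
        · have := hx.2.2 i hc hs ha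
          simp [hs, ha, hc, Real.exp_log (show 0 < x (some i) - (x none + rad g.1.1 x) by linarith)]
        · simp [hs, ha, hc]

lemma zf_eq (k : ℕ) (c : Option ι → κ) (g : Gam k c) (x : Option ι → ℝ) 
    (hx : (∀ a ∈ g.1.2, x (some a) < x none - rad g.1.1 x) ∧
    ∀ b, c (some b) = c none → b ∉ g.1.1 → b ∉ g.1.2 → x none + rad g.1.1 x < x (some b))
    (i i' : {i // i ∉ g.1.1}) (h : cg k c g i = cg k c g i') :
    zf k c g x i = zf k c g x i' ↔ x (some i) = x (some i') := by
  obtain ⟨i, hi⟩ := i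
  obtain ⟨j, hj⟩ := i'
  unfold zf
  unfold cg at h
  simp only at h ⊢
  split_ifs at h with h1 h2 h2
  · have e1 := hx.2 i h1.1 hi h1.2
    have e2 := hx.2 j h2.1 hj h2.2
    simp only [h1, h2, if_false, if_true]
    constructor
    · intro h
      have := Real.log_injOn_pos (show 0 < x (some i) - (x none + rad g.1.1 x) by linarith)
        (show 0 < x (some j) - (x none + rad g.1.1 x) by linarith) h
      linarith
    · intro h; rw [h]
  · have ec : c (some i) = c (some j) := Option.some_injective _ h
    by_cases hc : c (some j) = c none
    · have hA : i ∈ g.1.2 := by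
        by_contra hh; exact h1 ⟨ec.trans hc, hh⟩
      have hA' : j ∈ g.1.2 := by
        by_contra hh; exact h2 ⟨hc, hh⟩
      have e1 := hx.1 i hA
      have e2 := hx.1 j hA'
      simp only [hA, hA', if_true, neg_inj]
      constructor
      · intro h
        have := Real.log_injOn_pos (show 0 < x none - rad g.1.1 x - x (some i) by linarith)
          (show 0 < x none - rad g.1.1 x - x (some j) by linarith) h
        linarith
      · intro h; rw [h]
    · have hA : i ∉ g.1.2 := fun hh => hc (ec ▸ g.2.2.2.2 i hh)
      have hA' : j ∉ g.1.2 := fun hh => hc (g.2.2.2.2 j hh)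
      simp [hA, hA', ec, hc]

lemma zf_mem (k : ℕ) (c : Option ι → κ) (g : Gam k c) (x : Option ι → ℝ) (hx : x ∈ Vk k c g) :
    zf k c g x ∈ Mk k (cg k c g) :=
  (core hx.2 _ (zf_eq k c g x hx.2)).1 hx.1

lemma xb_mem (k : ℕ) (c : Option ι → κ) (g : Gam k c) (z : {i // i ∉ g.1.1} → ℝ) (y : ℝ)
    (v : g.1.1 → ℝ) (hz : z ∈ Mk k (cg k c g)) : xb k c g z y v ∈ Vk k c g := by
  have h := xb_ineq k c g z y v
  refine ⟨(core h _ (zf_eq k c g _ h)).2 ?_, h⟩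
  rwa [zf_xb]

/-- The chart. -/
noncomputable def chart (k : ℕ) (c : Option ι → κ) (g : Gam k c) :
    ((Mk k (cg k c g)) × ℝ) × (g.1.1 → ℝ) ≃ₜ Vk k c g where
  toFun p := ⟨xb k c g p.1.1.1 p.1.2 p.2, xb_mem k c g _ _ _ p.1.1.2⟩
  invFun x := ((⟨zf k c g x.1, zf_mem k c g x.1 x.2⟩, x.1 none), fun s => x.1 (some s) - x.1 none)
  left_inv p := by
    refine Prod.ext (Prod.ext (Subtype.ext ?_) ?_) ?_
    · exact zf_xb k c g _ _ _
    · rfl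
    · ext s
      simp [xb]
  right_inv x := Subtype.ext (xb_zf k c g x.1 x.2)
  continuous_toFun := by
    refine Continuous.subtype_mk (continuous_pi ?_) _
    rintro (_ | i)
    · exact continuous_snd.comp continuous_fst
    · simp only [xb, Option.elim]
      by_cases hs : i ∈ g.1.1
      · simp only [hs, dif_pos]; fun_prop
      · simp only [hs, dif_neg, not_false_iff]
        have hz : Continuous fun a : ((Mk k (cg k c g)) × ℝ) × (g.1.1 → ℝ) =>
          a.1.1.1 (⟨i, hs⟩ : {i // i ∉ g.1.1}) := (continuous_apply _).comp
            (continuous_subtype_val.comp (continuous_fst.comp continuous_fst))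
        have hy : Continuous fun a : ((Mk k (cg k c g)) × ℝ) × (g.1.1 → ℝ) =>
          ∑ s, |a.2 s| := by fun_prop
        have hy2 : Continuous fun a : ((Mk k (cg k c g)) × ℝ) × (g.1.1 → ℝ) => a.1.2 := by fun_prop
        split_ifs
        · exact (hy2.sub hy).sub (Real.continuous_exp.comp hz.neg)
        · exact (hy2.add hy).add (Real.continuous_exp.comp hz)
        · exact hz
  continuous_invFun := by
    have hr : Continuous fun x : Vk k c g => rad g.1.1 x.1 :=
      (rad_cont g.1.1).comp continuous_subtype_val
    have hx : ∀ o, Continuous fun x : Vk k c g => x.1 o := fun o =>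
      (continuous_apply o).comp continuous_subtype_val
    refine Continuous.prodMk (Continuous.prodMk (Continuous.subtype_mk (continuous_pi ?_) _)
      (hx none)) (continuous_pi fun s => (hx _).sub (hx _))
    rintro ⟨i, hi⟩
    simp only [zf]
    split_ifs with ha hc
    · refine Continuous.neg (Continuous.log (((hx _).sub hr).sub (hx _)) fun x => ?_)
      have := x.2.2.1 i ha
      exact ne_of_gt (by linarith)
    · refine Continuous.log ((hx _).sub ((hx _).add hr)) fun x => ?_
      have := x.2.2.2 i hc hi ha
      exact ne_of_gt (by linarith)
    · exact hx _

lemma HB_chart {k : ℕ} (c : Option ι → κ) (g : Gam k c) {b : ℕ → ℕ}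
    (hb : HB (F.obj (TopCat.of (Mk k (cg k c g)))) b) :
    HB (rel (inc (Set.inter_subset_left : Vk k c g ∩ Mk k c ⊆ Vk k c g)))
      (fun n => if n < g.1.1.card then 0 else b (n - g.1.1.card)) := by
  have h1 : HB (F.obj (TopCat.of (Mk k (cg k c g) × ℝ))) b := by
    refine hb.of_quasiIso' _ (quasiIso_homotopyEquiv
      (⟨fun p => p.1, by fun_prop⟩ : C(Mk k (cg k c g) × ℝ, Mk k (cg k c g))) 
      ⟨fun p => (p, 0), by fun_prop⟩ ?_ ?_)
    · exact homotopic_of_path _ _ (fun p s => (p.1, s * p.2)) (by fun_prop) (by simp) (by simp)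
    · exact ContinuousMap.Homotopic.refl _
  have h2 := HB_vec (S := g.1.1) h1
  rw [Fintype.card_coe] at h2
  have hm : ∀ p : ((Mk k (cg k c g)) × ℝ) × (g.1.1 → ℝ), (chart k c g p).1 ∈ Mk k c ↔ p.2 ≠ 0 := by
    intro p
    rw [Vk_mem_Mk (chart k c g p).2]
    constructor
    · rintro ⟨s, hs, h⟩ h0
      apply h
      simp [chart, xb, hs, h0]
    · intro h
      obtain ⟨s, hs⟩ := Function.ne_iff.1 h
      refine ⟨s.1, s.2, ?_⟩
      simpa [chart, xb] using hs
  refine HB_rel_homeo _ _ Subtype.val_injective (Set.inclusion_injective Set.inter_subset_left) ?_ (chart k c g) ?_ h2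
  · exact
      { toFun := fun p => ⟨(chart k c g p.1).1, (chart k c g p.1).2, (hm p.1).2 p.2⟩
        invFun := fun x => ⟨(chart k c g).symm ⟨x.1, x.2.1⟩, (hm _).1 (by
          rw [Homeomorph.apply_symm_apply]; exact x.2.2)⟩
        left_inv := fun p => by simp
        right_inv := fun x => by simp
        continuous_toFun := Continuous.subtype_mk (continuous_subtype_val.comp
          ((chart k c g).continuous.comp continuous_subtype_val)) _
        continuous_invFun := Continuous.subtype_mk ((chart k c g).symm.continuous.comp
          (Continuous.subtype_mk continuous_subtype_val _)) _ }
  · intro p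
    rfl

end
end KEq

open CategoryTheory
namespace KEq
open Limits AlgebraicTopology HomologicalComplex

section
set_option linter.unusedSectionVars false
open Classical
variable {ι κ : Type} [Fintype ι]

/-- Far away value. -/
noncomputable def far (x : ι → ℝ) : ℝ := 1 + ∑ i, |x i|

lemma far_ne (x : ι → ℝ) (i : ι) : x i < far x := by
  have : |x i| ≤ ∑ i, |x i| :=
    Finset.single_le_sum (f := fun s => |x s|) (fun _ _ => abs_nonneg _) (Finset.mem_univ i)
  have := le_abs_self (x i)
  unfold far
  linarith

/-- Extension by a value at the new point. -/
def ext1 (y : ℝ) (x : ι → ℝ) : Option ι → ℝ := fun o => o.elim y x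

lemma ext1_cont {P : Type} [TopologicalSpace P] {y : P → ℝ} {x : P → ι → ℝ} (hy : Continuous y)
    (hx : Continuous x) : Continuous fun p => ext1 (y p) (x p) := by
  refine continuous_pi ?_
  rintro (_ | i)
  · exact hy
  · exact (continuous_apply i).comp hx

lemma ext1_self (x : Option ι → ℝ) : ext1 (x none) (fun i => x (some i)) = x := by
  ext (_ | i) <;> rfl

lemma ext1_mem {k : ℕ} (hk : 2 ≤ k) (c : Option ι → κ) {x : ι → ℝ}
    (hx : x ∈ Mk k (fun i => c (some i))) : ext1 (far x) x ∈ Mk k c := by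
  by_contra h
  obtain ⟨T, h1, _, h3⟩ := not_Mk (show ext1 (far x) x ∈ Xk k c from hx) h
  obtain ⟨i, hi⟩ : T.Nonempty := Finset.card_pos.1 (by omega)
  exact absurd (h3 i hi) (far_ne x i).ne

lemma HB_X {k : ℕ} (c : Option ι → κ) {b : ℕ → ℕ}
    (hb : HB (F.obj (TopCat.of (Mk k (fun i => c (some i))))) b) :
    HB (F.obj (TopCat.of (Xk k c))) b := by
  have hx : Continuous fun (x : Xk k c) i => x.1 (some i) := by
    refine continuous_pi fun i => (continuous_apply (some i)).comp continuous_subtype_val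
  refine hb.of_quasiIso' _ (quasiIso_homotopyEquiv
      (⟨fun x => ⟨fun i => x.1 (some i), x.2⟩, Continuous.subtype_mk hx _⟩ :
        C(Xk k c, Mk k (fun i => c (some i))))
      ⟨fun x => ⟨ext1 0 x.1, x.2⟩,
        Continuous.subtype_mk (ext1_cont continuous_const continuous_subtype_val) _⟩ ?_ ?_)
  · refine homotopic_sub _ _ (fun x s => ext1 (s * x.1 none) fun i => x.1 (some i)) ?_ ?_ ?_ ?_
    · refine ext1_cont ?_ (hx.comp continuous_fst)
      exact continuous_snd.mul ((continuous_apply _).comp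
        (continuous_subtype_val.comp continuous_fst))
    · intro p s _ _
      exact p.2
    · intro p; simp
    · intro p
      simp only [one_mul]
      exact ext1_self p.1
  · exact ContinuousMap.Homotopic.refl _

lemma epi_X {k : ℕ} (hk : 2 ≤ k) (c : Option ι → κ) (n : ℕ) :
    Epi (homologyMap (F.map (inc (Mk_sub_Xk k c))) n) := by
  have hx : Continuous fun (x : Xk k c) i => x.1 (some i) := by
    refine continuous_pi fun i => (continuous_apply (some i)).comp continuous_subtype_val
  have hf : Continuous fun (x : Xk k c) => far (fun i => x.1 (some i)) := by
    have : Continuous (far : (ι → ℝ) → ℝ) := by unfold far; fun_prop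
    exact this.comp hx
  let s : C(Xk k c, Mk k c) := ⟨fun x => ⟨ext1 (far (fun i => x.1 (some i))) fun i => x.1 (some i),
    ext1_mem hk c x.2⟩, Continuous.subtype_mk (ext1_cont hf hx) _⟩
  let i : C(Mk k c, Xk k c) := ⟨Set.inclusion (Mk_sub_Xk k c), continuous_inclusion _⟩
  have h : (i.comp s).Homotopic (ContinuousMap.id _) := by
    refine homotopic_sub _ _ (fun x s => ext1 ((1 - s) * far (fun i => x.1 (some i)) + s * x.1 none)
      fun i => x.1 (some i)) ?_ ?_ ?_ ?_
    · refine ext1_cont ?_ (hx.comp continuous_fst)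
      exact ((continuous_const.sub continuous_snd).mul (hf.comp continuous_fst)).add
        (continuous_snd.mul ((continuous_apply _).comp
        (continuous_subtype_val.comp continuous_fst)))
    · intro p s _ _
      exact p.2
    · intro p; simp [i, s]
    · intro p
      simp only [one_mul, sub_self, zero_mul, zero_add]
      exact ext1_self p.1
  have e : homologyMap (F.map (hom s)) n ≫ homologyMap (F.map (inc (Mk_sub_Xk k c))) n = 𝟙 _ := by
    rw [← homologyMap_comp, ← F.map_comp]
    refine (F_homotopic h n).trans ?_
    have e : hom (ContinuousMap.id (Xk k c)) = 𝟙 _ := rfl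
    rw [e, F.map_id, homologyMap_id]
  have : Epi (homologyMap (F.map (hom s)) n ≫ homologyMap (F.map (inc (Mk_sub_Xk k c))) n) := by
    rw [e]; infer_instance
  exact epi_of_epi (homologyMap (F.map (hom s)) n) _

lemma HB_step {k : ℕ} (hk : 2 ≤ k) (c : Option ι → κ) {b0 : ℕ → ℕ} {b : Gam k c → ℕ → ℕ}
    (h0 : HB (F.obj (TopCat.of (Mk k (fun i => c (some i))))) b0)
    (hb : ∀ g, HB (F.obj (TopCat.of (Mk k (cg k c g)))) (b g)) :
    HB (F.obj (TopCat.of (Mk k c)))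
      (fun n => (∑ g, if n + 1 < k - 1 then 0 else b g (n + 1 - (k - 1))) + b0 n) := by
  have h1 := HB_union (Mk_open k c) (Vk_open k c) Vk_disj (fun g => HB_chart c g (hb g))
    Finset.univ
  have e : (Mk k c ∪ ⋃ g ∈ (Finset.univ : Finset (Gam k c)), Vk k c g) = Xk k c := by
    ext x
    constructor
    · rintro (h | h)
      · exact Mk_sub_Xk k c h
      · simp only [Set.mem_iUnion] at h
        obtain ⟨g, _, h⟩ := h
        exact h.1
    · intro h
      by_cases hm : x ∈ Mk k c
      · exact Or.inl hm
      · obtain ⟨g, hg⟩ := Vk_cover h hm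
        refine Or.inr ?_
        simp only [Set.mem_iUnion]
        exact ⟨g, Finset.mem_univ _, hg⟩
  have h2 := HB_rel_congr rfl e _ (Mk_sub_Xk k c) h1
  refine (HB.left (pair_shortExact (inc (Mk_sub_Xk k c))) (epi_X hk c) (HB_X c h0) h2).congr ?_
  intro n
  have : ∀ g : Gam k c, g.1.1.card = k - 1 := fun g => by have := g.2.1; omega
  simp only [this]

/-- Chains on a point. -/
noncomputable def pointIso (X : TopCat.{0}) [TotallyDisconnectedSpace X] :
    F.obj X ≅ ChainComplex.alternatingConst.obj ((ModuleCat.free ℤ).obj X) :=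
  (AlgebraicTopology.alternatingFaceMapComplex _).mapIso
    (((SimplicialObject.whiskering _ _).obj _).mapIso
    (TopCat.toSSetIsoConst X) ≪≫ Functor.constComp _ _ _) ≪≫
    AlgebraicTopology.alternatingFaceMapComplexConst.app _

/-- The base case. -/
lemma HB_point (X : Type) [TopologicalSpace X] [Unique X] :
    HB (F.obj (TopCat.of X)) (fun n => if n = 0 then 1 else 0) := by
  have : TotallyDisconnectedSpace (TopCat.of X) :=
    inferInstanceAs (TotallyDisconnectedSpace X)
  intro n
  rcases n with _ | n
  · have e := (HomologicalComplex.homologyFunctor _ _ 0).mapIso (pointIso (TopCat.of X)) ≪≫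
      ChainComplex.alternatingConstHomologyZero _
    refine FR.of_iso ?_ e.symm
    have e2 : (X →₀ ℤ) ≃ₗ[ℤ] (Fin 1 → ℤ) :=
      (Finsupp.linearEquivFunOnFinite ℤ ℤ X).trans
        (LinearEquiv.funCongrLeft ℤ ℤ (Equiv.ofUnique (Fin 1) X))
    exact ⟨e2⟩
  · simp only [Nat.add_eq_zero_iff, one_ne_zero, and_false, if_false]
    exact FR_zero (ExactAt.of_iso (ChainComplex.alternatingConst_exactAt _ _ (by simp))
      (pointIso (TopCat.of X)).symm).isZero_homology

end
end KEq

open CategoryTheory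
namespace KEq
open Limits AlgebraicTopology HomologicalComplex

section
set_option linter.unusedSectionVars false
open Classical Polynomial

lemma Nat_card_coe {α : Type} (s : Finset α) : Nat.card s = s.card := by simp

lemma Nat_card_sub {α : Type} [Fintype α] (p : α → Prop) :
    Nat.card {i // p i} = (Finset.univ.filter p).card := by
  rw [Nat.card_eq_fintype_card, Fintype.card_subtype]

/-- The Betti polynomial attached to a colouring. -/
noncomputable def BP {ι κ : Type} [Fintype ι] [Fintype κ] (P : ℕ → ℕ[X]) (c : ι → κ) : ℕ[X] :=
  ∏ l, P (Nat.card {i // c i = l})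

/-- The recursion. -/
def Rec (k : ℕ) (P : ℕ → ℕ[X]) : Prop :=
  P 0 = 1 ∧ ∀ N, P (N + 1) = P N + (Polynomial.X : ℕ[X]) ^ (k - 2) * (((N.choose (k - 1) : ℕ) : ℕ[X]) *
    ∑ a ∈ Finset.range (N - (k - 1) + 1), (((N - (k - 1)).choose a : ℕ) : ℕ[X]) *
      (P a * P (N - (k - 1) - a)))

variable {ι κ : Type} [Fintype ι] [Fintype κ]

/-- The common factor. -/
noncomputable def RP (P : ℕ → ℕ[X]) (c : Option ι → κ) : ℕ[X] :=
  ∏ l ∈ Finset.univ.erase (c none), P (Nat.card {i // c (some i) = l})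

/-- The number of old points of the new colour. -/
noncomputable def Nc (c : Option ι → κ) : ℕ := Nat.card {i // c (some i) = c none}

lemma BP_some (P : ℕ → ℕ[X]) (c : Option ι → κ) : BP P (fun i => c (some i)) = P (Nc c) * RP P c := by
  unfold BP RP Nc
  rw [← Finset.mul_prod_erase _ _ (Finset.mem_univ (c none))]

lemma BP_full (P : ℕ → ℕ[X]) (c : Option ι → κ) : BP P c = P (Nc c + 1) * RP P c := by
  unfold BP RP Nc
  rw [← Finset.mul_prod_erase _ _ (Finset.mem_univ (c none))]
  congr 1
  · congr 1
    rw [← Finite.card_option]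
    refine Nat.card_congr ⟨fun i => ?_, fun i => i.elim ⟨none, rfl⟩ fun i => ⟨some i.1, i.2⟩, ?_, ?_⟩
    · match i with
      | ⟨none, h⟩ => exact none
      | ⟨some i, h⟩ => exact some ⟨i, h⟩
    · rintro ⟨_ | i, h⟩ <;> rfl
    · rintro (_ | ⟨i, h⟩) <;> rfl
  · refine Finset.prod_congr rfl fun l hl => ?_
    congr 1
    have hl := Finset.ne_of_mem_erase hl
    refine Nat.card_congr ⟨fun i => ?_, fun i => ⟨some i.1, i.2⟩, ?_, ?_⟩
    · match i with
      | ⟨none, h⟩ => exact absurd h.symm hl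
      | ⟨some i, h⟩ => exact ⟨i, h⟩
    · rintro ⟨_ | i, h⟩
      · exact absurd h.symm hl
      · rfl
    · rintro ⟨i, h⟩
      rfl

lemma BP_cg (P : ℕ → ℕ[X]) {k : ℕ} (c : Option ι → κ) (g : Gam k c) :
    BP P (cg k c g) = P g.1.2.card * P (Nc c - (k - 1) - g.1.2.card) * RP P c := by
  unfold BP RP
  rw [Fintype.prod_option, ← Finset.mul_prod_erase _ _ (Finset.mem_univ (c none)), ← mul_assoc,
    mul_comm (P _) (P _)]
  congr 1
  · congr 2
    · rw [← Nat_card_coe]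
      refine Nat.card_congr ⟨fun i => ⟨i.1.1, ?_⟩, fun i => ⟨⟨i.1, ?_⟩, ?_⟩, ?_, ?_⟩
      · have := i.2
        unfold cg at this
        split_ifs at this with h
        have h2 := Option.some_injective _ this
        by_contra h3
        exact h ⟨h2, h3⟩
      · exact fun h => Finset.disjoint_left.1 g.2.2.1 h i.2
      · simp [cg, i.2, g.2.2.2.2 i.1 i.2]
      · intro i; rfl
      · intro i; rfl
    · have e : Nat.card {i : {i // i ∉ g.1.1} // cg k c g i = none} =
        (((Finset.univ.filter (fun i => c (some i) = c none)) \ g.1.1) \ g.1.2 : Finset ι).card := by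
        rw [← Nat_card_coe]
        refine Nat.card_congr ⟨fun i => ⟨i.1.1, ?_⟩, fun i => ⟨⟨i.1, ?_⟩, ?_⟩, ?_, ?_⟩
        · have := i.2
          unfold cg at this
          split_ifs at this with h
          simp [h, i.1.2]
        · have := i.2
          simp only [Finset.mem_sdiff] at this
          exact this.1.2
        · have := i.2
          simp only [Finset.mem_sdiff, Finset.mem_filter, Finset.mem_univ, true_and] at this
          simp [cg, this.1, this.2]
        · intro i; rfl
        · intro i; rfl
      rw [e, Finset.card_sdiff_of_subset, Finset.card_sdiff_of_subset]
      · have := g.2.1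
        rw [Nc, Nat_card_sub]
        congr 2
        omega
      · intro i hi
        simpa using g.2.2.2.1 i hi
      · intro i hi
        simp only [Finset.mem_sdiff, Finset.mem_filter, Finset.mem_univ, true_and]
        exact ⟨g.2.2.2.2 i hi, fun h => Finset.disjoint_left.1 g.2.2.1 h hi⟩
  · refine Finset.prod_congr rfl fun l hl => ?_
    congr 1
    have hl := Finset.ne_of_mem_erase hl
    refine Nat.card_congr ⟨fun i => ⟨i.1.1, ?_⟩, fun i => ⟨⟨i.1, ?_⟩, ?_⟩, ?_, ?_⟩
    · have := i.2
      unfold cg at this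
      split_ifs at this with h
      exact Option.some_injective _ this
    · exact fun h => hl (i.2.symm.trans (g.2.2.2.1 _ h))
    · simp [cg, i.2, hl]
    · intro i; rfl
    · intro i; rfl

lemma sum_Gam {k : ℕ} (hk : 1 ≤ k) (c : Option ι → κ) (f : ℕ → ℕ[X]) :
    ∑ g : Gam k c, f g.1.2.card = (((Nc c).choose (k - 1) : ℕ) : ℕ[X]) *
    ∑ a ∈ Finset.range (Nc c - (k - 1) + 1), (((Nc c - (k - 1)).choose a : ℕ) : ℕ[X]) * f a := by
  set D : Finset ι := Finset.univ.filter (fun i => c (some i) = c none) with hD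
  have hN : Nc c = D.card := by rw [Nc, Nat_card_sub]
  set r : Finset (Finset ι × Finset ι) := Finset.univ.filter (fun g => g.1.card + 1 = k ∧
    Disjoint g.1 g.2 ∧ (∀ i ∈ g.1, c (some i) = c none) ∧ ∀ i ∈ g.2, c (some i) = c none) with hr
  have e1 : ∑ g : Gam k c, f g.1.2.card = ∑ g ∈ r, f g.2.card := by
    rw [Finset.sum_subtype r (p := fun g : Finset ι × Finset ι => g.1.card + 1 = k ∧
    Disjoint g.1 g.2 ∧ (∀ i ∈ g.1, c (some i) = c none) ∧ ∀ i ∈ g.2, c (some i) = c none)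
      (fun x => by simp [hr]) (fun g => f g.2.card)]
    rfl
  rw [e1, Finset.sum_finset_product r (D.powersetCard (k - 1)) (fun S => (D \ S).powerset)]
  · rw [Finset.sum_congr rfl (g := fun _ => ∑ a ∈ Finset.range (Nc c - (k - 1) + 1),
      (((Nc c - (k - 1)).choose a : ℕ) : ℕ[X]) * f a)]
    · rw [Finset.sum_const, Finset.card_powersetCard, ← hN, nsmul_eq_mul]
    · intro S hS
      rw [Finset.mem_powersetCard] at hS
      have := Finset.sum_powerset_apply_card f (x := D \ S)
      rw [this, Finset.card_sdiff_of_subset hS.1, hS.2, ← hN]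
      simp only [nsmul_eq_mul]
  · rintro ⟨S, A⟩
    simp only [hr, Finset.mem_filter, Finset.mem_univ, true_and, Finset.mem_powersetCard,
      Finset.mem_powerset, Finset.subset_iff, hD, Finset.mem_sdiff, Finset.disjoint_left]
    constructor
    · rintro ⟨h1, h2, h3, h4⟩
      exact ⟨⟨fun i hi => by simpa using h3 i hi, by omega⟩,
        fun i hi => ⟨by simpa using h4 i hi, fun h => h2 h hi⟩⟩
    · rintro ⟨⟨h1, h2⟩, h3⟩
      exact ⟨by omega, fun i hi hi' => (h3 hi').2 hi, fun i hi => by simpa using h1 i hi, fun i hi => by simpa using (h3 hi).1⟩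

lemma BP_rec {k : ℕ} (hk : 2 ≤ k) {P : ℕ → ℕ[X]} (hP : Rec k P) (c : Option ι → κ) :
    BP P c = BP P (fun i => c (some i)) + (Polynomial.X : ℕ[X]) ^ (k - 2) * ∑ g : Gam k c, BP P (cg k c g) := by
  simp only [BP_cg]
  rw [← Finset.sum_mul, sum_Gam (by omega) c (fun a => P a * P (Nc c - (k - 1) - a)), BP_some,
    BP_full, hP.2]
  ring

lemma Mk_homeo_HB {ι' : Type} (e : ι ≃ ι') (k : ℕ) (c : ι' → κ) {b : ℕ → ℕ}
    (hb : HB (F.obj (TopCat.of (Mk k (fun i => c (e i))))) b) : HB (F.obj (TopCat.of (Mk k c))) b := by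
  refine HB_homeo (Homeomorph.subtype (Homeomorph.piCongrLeft (Y := fun _ => ℝ) e) ?_) hb
  intro x
  have hx : ∀ i, Homeomorph.piCongrLeft (Y := fun _ => ℝ) e x (e i) = x i := by
    intro i; simp [Homeomorph.piCongrLeft, Equiv.piCongrLeft]
  constructor
  · intro h S hS hc h'
    refine h (S.map e.symm.toEmbedding) (by simpa using hS) ?_ ?_
    · intro i hi j hj
      exact hc _ (by simpa using hi) _ (by simpa using hj)
    · intro i hi j hj
      rw [← hx i, ← hx j]
      exact h' _ (by simpa using hi) _ (by simpa using hj)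
  · intro h S hS hc h'
    refine h (S.map e.toEmbedding) (by simpa using hS) ?_ ?_
    · intro i hi j hj
      obtain ⟨i, hi', rfl⟩ := Finset.mem_map.1 hi
      obtain ⟨j, hj', rfl⟩ := Finset.mem_map.1 hj
      exact hc _ hi' _ hj'
    · intro i hi j hj
      obtain ⟨i, hi', rfl⟩ := Finset.mem_map.1 hi
      obtain ⟨j, hj', rfl⟩ := Finset.mem_map.1 hj
      exact ((hx i).trans (h' _ hi' _ hj')).trans (hx j).symm

lemma BP_equiv {ι' : Type} [Fintype ι'] (e : ι ≃ ι') (P : ℕ → ℕ[X]) (c : ι' → κ) :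
    BP P (fun i => c (e i)) = BP P c := by
  unfold BP
  refine Finset.prod_congr rfl fun l _ => ?_
  congr 1
  exact Nat.card_congr (e.subtypeEquiv fun _ => Iff.rfl)

theorem HB_main {k : ℕ} (hk : 2 ≤ k) {P : ℕ → ℕ[X]} (hP : Rec k P) (m : ℕ) :
    ∀ (ι κ : Type) [Fintype ι] [Fintype κ] (c : ι → κ), Fintype.card ι = m →
      HB (F.obj (TopCat.of (Mk k c))) (fun n => (BP P c).coeff n) := by
  induction m using Nat.strong_induction_on with
  | _ m ih =>
  intro ι κ _ _ c hm
  rcases m with _ | m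
  · have : IsEmpty ι := Fintype.card_eq_zero_iff.1 hm
    have hM : (fun i => isEmptyElim i : ι → ℝ) ∈ Mk k c := by
      intro S hS
      rw [Finset.eq_empty_of_isEmpty S, Finset.card_empty] at hS
      omega
    have : Unique (Mk k c) := ⟨⟨⟨_, hM⟩⟩, fun x => Subtype.ext (Subsingleton.elim _ _)⟩
    refine (HB_point (Mk k c)).congr fun n => ?_
    have : BP P c = 1 := by
      unfold BP
      refine Finset.prod_eq_one fun l _ => ?_
      rw [Nat.card_of_isEmpty, hP.1]
    rw [this, Polynomial.coeff_one]
  · have e : Option (Fin m) ≃ ι := Fintype.equivOfCardEq (by simp [hm])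
    refine Mk_homeo_HB e k c ?_
    rw [← BP_equiv e P c]
    set c' : Option (Fin m) → κ := fun i => c (e i)
    refine (HB_step hk c' (ih m (by omega) (Fin m) κ (fun i => c' (some i)) (by simp))
      (fun g => ih _ ?_ _ _ (cg k c' g) rfl)).congr ?_
    · have := Fintype.card_subtype_le (fun i : Fin m => i ∉ g.1.1)
      simp only [Fintype.card_fin] at this
      exact lt_of_le_of_lt this (by omega)
    · intro n
      rw [BP_rec hk hP c', Polynomial.coeff_add, Polynomial.coeff_X_pow_mul', add_comm]
      congr 1
      split_ifs with h1 h2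
      · omega
      · simp
      · rw [Polynomial.finsetSum_coeff]
        refine Finset.sum_congr rfl fun g _ => ?_
        congr 1
        omega
      · omega

end
end KEq

open CategoryTheory
namespace KEq
open Limits AlgebraicTopology HomologicalComplex

section

/-- The Betti number of the statement. -/
def aa (k t N : ℕ) : ℕ :=
  ∑ μ ∈ (Finset.Nat.antidiagonalTuple (t + 1) N).filter
                (fun μ => ∀ m : Fin t, k ≤ μ m.castSucc),
              Nat.multinomial Finset.univ μ *
                ∏ m : Fin t, (μ m.castSucc - 1).choose (k - 1)

lemma aa_eq (k : ℕ) (hk : 2 ≤ k) (t N : ℕ) :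
    aa k t N = ∑ μ ∈ Finset.Nat.antidiagonalTuple (t + 1) N,
      Nat.multinomial Finset.univ μ * ∏ m : Fin t, (μ m.castSucc - 1).choose (k - 1) := by
  unfold aa
  apply Finset.sum_filter_of_ne
  intro μ _ hne m
  by_contra hlt
  apply hne
  rw [Finset.prod_eq_zero (Finset.mem_univ m), mul_zero]
  apply Nat.choose_eq_zero_of_lt
  omega

lemma multinomial_fin_cons {t : ℕ} (m : ℕ) (μ : Fin t → ℕ) :
    Nat.multinomial Finset.univ (Fin.cons m μ : Fin (t + 1) → ℕ)
      = (m + ∑ i, μ i).choose m * Nat.multinomial Finset.univ μ := by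
  have h1 := Nat.multinomial_spec Finset.univ (Fin.cons m μ : Fin (t + 1) → ℕ)
  have h2 := Nat.multinomial_spec Finset.univ μ
  rw [Fin.prod_univ_succ, Fin.sum_univ_succ] at h1
  simp only [Fin.cons_zero, Fin.cons_succ] at h1
  have h3 := Nat.add_choose_mul_factorial_mul_factorial m (∑ i, μ i)
  rw [← Nat.choose_symm_add] at h3
  have hpos : 0 < m.factorial * ∏ i, (μ i).factorial :=
    Nat.mul_pos (Nat.factorial_pos _) (Finset.prod_pos fun i _ => Nat.factorial_pos _)
  apply Nat.eq_of_mul_eq_mul_left hpos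
  rw [h1, ← h3, ← h2]
  ring

lemma aa_zero (k : ℕ) (hk : 2 ≤ k) (N : ℕ) : aa k 0 N = 1 := by
  rw [aa_eq k hk, Finset.Nat.antidiagonalTuple_one]
  simp [Nat.multinomial_singleton]

lemma aa_succ (k : ℕ) (hk : 2 ≤ k) (t N : ℕ) :
    aa k (t + 1) N = ∑ p ∈ Finset.HasAntidiagonal.antidiagonal N,
      N.choose p.1 * ((p.1 - 1).choose (k - 1) * aa k t p.2) := by
  simp_rw [aa_eq k hk, Finset.mul_sum]
  rw [Finset.sum_sigma']
  symm
  refine Finset.sum_bij' (fun x _ => (Fin.cons x.1.1 x.2 : Fin (t + 2) → ℕ))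
    (fun μ _ => ⟨(μ 0, ∑ i, Fin.tail μ i), Fin.tail μ⟩) ?_ ?_ ?_ ?_ ?_
  · rintro ⟨⟨m, r⟩, μ⟩ h
    simp only [Finset.mem_sigma, Finset.HasAntidiagonal.mem_antidiagonal, Finset.Nat.mem_antidiagonalTuple] at h ⊢
    rw [Fin.sum_univ_succ]
    simp only [Fin.cons_zero, Fin.cons_succ]
    omega
  · intro μ h
    simp only [Finset.mem_sigma, Finset.HasAntidiagonal.mem_antidiagonal, Finset.Nat.mem_antidiagonalTuple] at h ⊢
    rw [Fin.sum_univ_succ] at h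
    exact ⟨h, trivial⟩
  · rintro ⟨⟨m, r⟩, μ⟩ h
    simp only [Finset.mem_sigma, Finset.HasAntidiagonal.mem_antidiagonal, Finset.Nat.mem_antidiagonalTuple] at h
    obtain ⟨h1, rfl⟩ := h
    simp
  · intro μ h
    simp
  · rintro ⟨⟨m, r⟩, μ⟩ h
    simp only [Finset.mem_sigma, Finset.HasAntidiagonal.mem_antidiagonal, Finset.Nat.mem_antidiagonalTuple] at h
    obtain ⟨rfl, rfl⟩ := h
    simp only [multinomial_fin_cons]
    rw [Fin.prod_univ_succ]
    simp only [Fin.castSucc_zero, Fin.cons_zero, ← Fin.succ_castSucc, Fin.cons_succ]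
    ring

lemma aa_vanish (k : ℕ) (hk : 2 ≤ k) (t : ℕ) : ∀ N, N < t → aa k t N = 0 := by
  induction t with
  | zero => intro N h; omega
  | succ t ih =>
    intro N h
    rw [aa_succ k hk]
    apply Finset.sum_eq_zero
    rintro ⟨m, r⟩ hp
    simp only [Finset.HasAntidiagonal.mem_antidiagonal] at hp
    rcases Nat.eq_zero_or_pos m with rfl | hm
    · simp only
      rw [Nat.choose_eq_zero_of_lt (show 0 - 1 < k - 1 by omega)]; simp
    · simp only
      rw [ih r (by omega)]; simp

open PowerSeries in
/-- exponential generating function -/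
noncomputable def egf (a : ℕ → ℕ) : ℚ⟦X⟧ := PowerSeries.mk fun n => (a n : ℚ) / n.factorial

lemma egf_mul (a b : ℕ → ℕ) :
    egf a * egf b = egf (fun N => ∑ p ∈ Finset.HasAntidiagonal.antidiagonal N, N.choose p.1 * (a p.1 * b p.2)) := by
  ext N
  rw [PowerSeries.coeff_mul]
  simp only [egf, PowerSeries.coeff_mk]
  push_cast
  rw [Finset.sum_div]
  apply Finset.sum_congr rfl
  rintro ⟨m, r⟩ hp
  simp only [Finset.HasAntidiagonal.mem_antidiagonal] at hp
  subst hp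
  simp only
  rw [Nat.cast_add_choose]
  have h1 : ((m.factorial : ℕ) : ℚ) ≠ 0 := by positivity
  have h2 : ((r.factorial : ℕ) : ℚ) ≠ 0 := by positivity
  have h3 : (((m+r).factorial : ℕ) : ℚ) ≠ 0 := by positivity
  field_simp

lemma egf_deriv (a : ℕ → ℕ) : PowerSeries.derivative ℚ (egf a) = egf (fun N => a (N + 1)) := by
  ext N
  rw [PowerSeries.coeff_derivative]
  simp only [egf, PowerSeries.coeff_mk]
  rw [Nat.factorial_succ]
  push_cast
  have h1 : ((N.factorial : ℕ) : ℚ) ≠ 0 := by positivity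
  have h2 : (N : ℚ) + 1 ≠ 0 := by positivity
  field_simp

lemma egf_shift (r : ℕ) (b : ℕ → ℕ) :
    (PowerSeries.X : PowerSeries ℚ) ^ r * (PowerSeries.C ((r.factorial : ℚ)⁻¹) * egf b)
      = egf (fun N => N.choose r * b (N - r)) := by
  ext N
  rw [PowerSeries.coeff_X_pow_mul']
  split_ifs with h
  · rw [PowerSeries.coeff_C_mul]
    simp only [egf, PowerSeries.coeff_mk]
    obtain ⟨s, rfl⟩ := Nat.exists_eq_add_of_le h
    rw [Nat.add_sub_cancel_left]
    push_cast
    rw [Nat.cast_add_choose]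
    have h1 : ((r.factorial : ℕ) : ℚ) ≠ 0 := by positivity
    have h2 : ((s.factorial : ℕ) : ℚ) ≠ 0 := by positivity
    have h3 : (((r+s).factorial : ℕ) : ℚ) ≠ 0 := by positivity
    field_simp
  · simp only [egf, PowerSeries.coeff_mk]
    rw [Nat.choose_eq_zero_of_lt (by omega)]
    simp

lemma egf_inj {a b : ℕ → ℕ} (h : egf a = egf b) (N : ℕ) : a N = b N := by
  have := congrArg (PowerSeries.coeff N) h
  simp only [egf, PowerSeries.coeff_mk] at this
  have h1 : ((N.factorial : ℕ) : ℚ) ≠ 0 := by positivity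
  rw [div_left_inj' h1] at this
  exact_mod_cast this

lemma egf_add (a b : ℕ → ℕ) : egf a + egf b = egf (fun N => a N + b N) := by
  ext N
  simp only [egf, map_add, PowerSeries.coeff_mk]
  push_cast
  ring

lemma egf_sum {α : Type} (s : Finset α) (a : α → ℕ → ℕ) :
    ∑ i ∈ s, egf (a i) = egf (fun N => ∑ i ∈ s, a i N) := by
  ext N
  simp only [egf, map_sum, PowerSeries.coeff_mk]
  push_cast
  rw [Finset.sum_div]

lemma aa_egf (k : ℕ) (hk : 2 ≤ k) (t : ℕ) :
    egf (aa k t) = egf (fun m => (m - 1).choose (k - 1)) ^ t * egf (fun _ => 1) := by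
  induction t with
  | zero =>
    rw [pow_zero, one_mul]
    congr 1
    ext N; exact aa_zero k hk N
  | succ t ih =>
    rw [pow_succ', mul_assoc, ← ih, egf_mul]
    congr 1
    ext N
    exact aa_succ k hk t N

lemma aa_rec (k : ℕ) (hk : 2 ≤ k) (t N : ℕ) :
    aa k (t + 1) (N + 1) = aa k (t + 1) N + N.choose (k - 1) *
      ∑ q ∈ Finset.HasAntidiagonal.antidiagonal t, ∑ p ∈ Finset.HasAntidiagonal.antidiagonal (N - (k - 1)),
        (N - (k - 1)).choose p.1 * (aa k q.1 p.1 * aa k q.2 p.2) := by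
  have hexp : PowerSeries.derivative ℚ (egf (fun _ => 1)) = egf (fun _ => 1) := egf_deriv _
  have hf : PowerSeries.derivative ℚ (egf (fun m => (m - 1).choose (k - 1)))
      = (PowerSeries.X : PowerSeries ℚ) ^ (k-1) * (PowerSeries.C (((k-1).factorial : ℚ)⁻¹) *
        egf (fun _ => 1)) := by
    rw [egf_deriv, egf_shift]
    simp
  have key : PowerSeries.derivative ℚ (egf (aa k (t + 1))) = egf (aa k (t + 1)) +
      (PowerSeries.X : PowerSeries ℚ) ^ (k-1) * (PowerSeries.C (((k-1).factorial : ℚ)⁻¹) *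
        ∑ q ∈ Finset.HasAntidiagonal.antidiagonal t, egf (aa k q.1) * egf (aa k q.2)) := by
    have hs : ∑ q ∈ Finset.HasAntidiagonal.antidiagonal t, egf (aa k q.1) * egf (aa k q.2)
        = ((t + 1 : ℕ) : PowerSeries ℚ) * (egf (fun m => (m - 1).choose (k - 1)) ^ t
          * (egf (fun _ => 1) * egf (fun _ => 1))) := by
      rw [← Finset.Nat.card_antidiagonal t, ← nsmul_eq_mul, ← Finset.sum_const]
      apply Finset.sum_congr rfl
      rintro ⟨i, j⟩ hq
      simp only [Finset.HasAntidiagonal.mem_antidiagonal] at hq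
      rw [aa_egf k hk, aa_egf k hk, ← hq, pow_add]
      ring
    rw [hs, aa_egf k hk, Derivation.leibniz, PowerSeries.derivative_pow, hexp, hf]
    simp only [smul_eq_mul, Nat.add_sub_cancel]
    ring
  simp_rw [egf_mul] at key
  rw [egf_sum, egf_shift, egf_add, egf_deriv] at key
  exact egf_inj key N

open Polynomial

/-- the Betti polynomial, in a variable of degree `k - 2` -/
noncomputable def pp (k N : ℕ) : ℕ[X] := ∑ t ∈ Finset.range (N + 1), monomial t (aa k t N)

lemma pp_coeff (k : ℕ) (hk : 2 ≤ k) (N t : ℕ) : (pp k N).coeff t = aa k t N := by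
  unfold pp
  rw [finsetSum_coeff]
  simp only [coeff_monomial]
  rw [Finset.sum_ite_eq']
  split_ifs with h
  · rfl
  · rw [aa_vanish k hk]
    simpa using h

lemma pp_rec (k : ℕ) (hk : 2 ≤ k) (N : ℕ) :
    pp k (N+1) = pp k N + (Polynomial.X : ℕ[X]) * (((N.choose (k-1) : ℕ) : ℕ[X]) *
      ∑ a ∈ Finset.range (N-(k-1)+1), (((N-(k-1)).choose a : ℕ) : ℕ[X]) *
        (pp k a * pp k (N-(k-1)-a))) := by
  ext t
  rw [coeff_add, pp_coeff k hk, pp_coeff k hk]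
  cases t with
  | zero => rw [aa_zero k hk, aa_zero k hk, coeff_X_mul_zero, add_zero]
  | succ t =>
    rw [coeff_X_mul, aa_rec k hk, coeff_natCast_mul, finsetSum_coeff]
    congr 2
    rw [Finset.sum_comm]
    rw [Finset.Nat.sum_antidiagonal_eq_sum_range_succ_mk]
    apply Finset.sum_congr rfl
    intro a _
    rw [coeff_natCast_mul, coeff_mul, Finset.mul_sum]
    simp_rw [pp_coeff k hk]
    simp

/-- the Betti polynomial -/
noncomputable def PP (k N : ℕ) : ℕ[X] := Polynomial.expand ℕ (k - 2) (pp k N)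

lemma PP_rec (k : ℕ) (hk : 2 ≤ k) : Rec k (PP k) := by
  constructor
  · have : pp k 0 = 1 := by
      simp [pp, aa_zero k hk]
    rw [PP, this, map_one]
  · intro N
    unfold PP
    rw [pp_rec k hk]
    simp only [map_add, map_mul, map_sum, map_natCast, expand_X]

lemma PP_coeff (k : ℕ) (hk : 3 ≤ k) (N t : ℕ) : (PP k N).coeff (t * (k - 2)) = aa k t N := by
  rw [PP, coeff_expand_mul (by omega), pp_coeff k (by omega)]

end

lemma Mk_eq (n k : ℕ) : Mk k (fun _ : Fin (n + 1) => ()) = kEqualComplement n k := by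
  ext x
  simp [Mk, kEqualComplement]

lemma BP_unit (n : ℕ) (P : ℕ → Polynomial ℕ) : BP P (fun _ : Fin (n + 1) => ()) = P (n + 1) := by
  simp [BP]

end KEq

theorem betti_numbers_of_k_equal_complement (n k : ℕ) (hk : 3 ≤ k) (hkn : k ≤ n) (t : ℕ) :
    Nonempty
      ((singularHomology (TopCat.of (kEqualComplement n k)) (t * (k - 2))) ≃ₗ[ℤ]
        (Fin (∑ μ ∈ (Finset.Nat.antidiagonalTuple (t + 1) (n + 1)).filter
                (fun μ => ∀ m : Fin t, k ≤ μ m.castSucc),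
              Nat.multinomial Finset.univ μ *
                ∏ m : Fin t, (μ m.castSucc - 1).choose (k - 1)) → ℤ)) := by
  have h := KEq.HB_main (k := k) (by omega) (KEq.PP_rec k (by omega)) (n + 1) (Fin (n + 1)) Unit
    (fun _ => ()) (by simp) (t * (k - 2))
  rw [KEq.BP_unit] at h
  beta_reduce at h
  rw [KEq.PP_coeff k hk, KEq.Mk_eq] at h
  exact h
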